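/- arXiv:1908.06156 — 4 statements merged into one kernel-verified Lean document; each statement's English description precedes it below -/
import Mathlib

section
/- Let R ⊆ Gh(I) be a B-ring. For every l ≥ 1 and all i, j ∈ I, the abelian groups Ext^l_R(ℤ_i, ℤ_j) and Tor^R_l(ℤ_i, ℤ_j) are finite. -/
open CategoryTheory

noncomputable section

/-- A subring `R ⊆ Gh I = ∏_{i ∈ I} ℤ` is a *B-ring* if for all distinct `i, j ∈ I`
there is `r ∈ R` with `r i ≠ 0` and `r j = 0`. -/
def IsBRing {I : Type*} (R : Subring (I → ℤ)) : Prop :=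
  ∀ i j : I, i ≠ j → ∃ r ∈ R, r i ≠ 0 ∧ r j = 0

/-- `ℤ_i`: the `R`-module `ℤ` where `r ∈ R ⊆ ∏_{i ∈ I} ℤ` acts by multiplication by `r i`. -/
def ZMod_ {I : Type} (R : Subring (I → ℤ)) (i : I) : ModuleCat R :=
  letI : Module R ℤ := Module.compHom ℤ ((Pi.evalRingHom (fun _ => ℤ) i).comp R.subtype)
  ModuleCat.of R ℤ

open CategoryTheory.Limits

universe u

theorem CategoryTheory.Functor.zsmul_id_leftDerived_obj {C D : Type*} [Category* C] [Abelian C]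
    [HasProjectiveResolutions C] [Category* D] [Abelian D] (F : C ⥤ D) [F.Additive] (X : C)
    (n : ℤ) (l : ℕ) :
    n • 𝟙 ((F.leftDerived l).obj X) = (F.leftDerived l).map (n • 𝟙 X) := by
  let P := projectiveResolution X
  have w : (n • 𝟙 P.complex) ≫ P.π = P.π ≫ (ChainComplex.single₀ C).map (n • 𝟙 X) := by
    simp
  rw [F.leftDerived_map_eq l (n • 𝟙 X) (n • 𝟙 P.complex) w, Functor.map_zsmul, Functor.map_id]
  simp

/-- If multiplication by `n` on `X` factors through a projective object, then `n` annihilates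
the higher left derived functors at `X`. -/
theorem CategoryTheory.Functor.zsmul_id_leftDerived_succ_eq_zero {C D : Type*} [Category* C]
    [Abelian C] [HasProjectiveResolutions C] [Category* D] [Abelian D] (F : C ⥤ D) [F.Additive]
    {X P : C} [Projective P] (a : X ⟶ P) (b : P ⟶ X) (n : ℤ) (hab : a ≫ b = n • 𝟙 X) (l : ℕ) :
    n • 𝟙 ((F.leftDerived (l + 1)).obj X) = 0 := by
  rw [F.zsmul_id_leftDerived_obj, ← hab, Functor.map_comp,
    (F.isZero_leftDerived_obj_projective_succ l P).eq_zero_of_tgt ((F.leftDerived (l + 1)).map a),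
    zero_comp]

theorem HomologicalComplex.finite_homology {A : Type*} [Ring A] [IsNoetherianRing A] {ι : Type*}
    {c : ComplexShape ι} (K : HomologicalComplex (ModuleCat A) c) (n : ι)
    [Module.Finite A (K.X n)] : Module.Finite A (K.homology n) := by
  have : Module.Finite A (K.cycles n) := Module.Finite.of_injective (K.iCycles n).hom
    ((ModuleCat.mono_iff_injective _).1 inferInstance)
  exact Module.Finite.of_surjective (K.homologyπ n).hom
    ((ModuleCat.epi_iff_surjective _).1 inferInstance)

theorem ChainComplex.quasiIso_toSingle₀Equiv_symm {C : Type*} [Category* C] [Abelian C]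
    {K : ChainComplex C ℕ} {Z : C} (p : K.X 0 ⟶ Z) [Epi p] (w : K.d 1 0 ≫ p = 0)
    (h₀ : (ShortComplex.mk _ _ w).Exact) (h : ∀ n, K.ExactAt (n + 1)) :
    QuasiIso ((ChainComplex.toSingle₀Equiv K Z).symm ⟨p, w⟩) where
  quasiIsoAt n := by
    cases n with
    | zero =>
      rw [ChainComplex.quasiIsoAt₀_iff, ShortComplex.quasiIso_iff_of_zeros']
      · refine (ShortComplex.exact_and_epi_g_iff_of_iso ?_).2 ⟨h₀, inferInstance⟩
        exact ShortComplex.isoMk (Iso.refl _) (Iso.refl _) (Iso.refl _)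
          ((Category.id_comp _).trans (Category.comp_id _).symm)
          ((Category.id_comp _).trans
            ((ChainComplex.toSingle₀Equiv_symm_apply_f_zero p w).symm.trans
              (Category.comp_id _).symm))
      · exact K.shape 0 0 (by simp)
      · rfl
      · rfl
    | succ n =>
      rw [quasiIsoAt_iff_exactAt']
      · exact h n
      · apply ChainComplex.exactAt_succ_single_obj

namespace ModuleCat

variable {R : Type u} [Ring R]

theorem exists_projective_epi_finite (M : ModuleCat.{u} R) :
    ∃ (P : ModuleCat.{u} R) (p : P ⟶ M), Projective P ∧ Epi p ∧
      (Module.Finite R M → Module.Finite R P) := by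
  by_cases h : Module.Finite R M
  · obtain ⟨n, f, hf⟩ := Module.Finite.exists_fin' R M
    exact ⟨ModuleCat.of R (Fin n → R), ModuleCat.ofHom f,
      (IsProjective.iff_projective (Fin n → R)).1 inferInstance,
      (ModuleCat.epi_iff_surjective _).2 hf, fun _ => inferInstanceAs (Module.Finite R (Fin n → R))⟩
  · exact ⟨Projective.over M, Projective.π M, inferInstance, inferInstance, fun h' => (h h').elim⟩

/-- A projective module mapping onto `M`, finitely generated whenever `M` is. -/
def cover (M : ModuleCat.{u} R) : ModuleCat.{u} R := M.exists_projective_epi_finite.choose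

/-- The epimorphism from `M.cover` to `M`. -/
def coverπ (M : ModuleCat.{u} R) : M.cover ⟶ M :=
  M.exists_projective_epi_finite.choose_spec.choose

instance (M : ModuleCat.{u} R) : Projective M.cover :=
  M.exists_projective_epi_finite.choose_spec.choose_spec.1

instance (M : ModuleCat.{u} R) : Epi M.coverπ :=
  M.exists_projective_epi_finite.choose_spec.choose_spec.2.1

instance (M : ModuleCat.{u} R) [h : Module.Finite R M] : Module.Finite R M.cover :=
  M.exists_projective_epi_finite.choose_spec.choose_spec.2.2 h

/-- The map onto the kernel of `f` from its cover, followed by the inclusion. -/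
def syzygyMap {X Y : ModuleCat.{u} R} (f : X ⟶ Y) : (kernel f).cover ⟶ X :=
  (kernel f).coverπ ≫ kernel.ι f

@[simp]
theorem syzygyMap_comp {X Y : ModuleCat.{u} R} (f : X ⟶ Y) : syzygyMap f ≫ f = 0 := by
  simp [syzygyMap]

theorem exact_syzygyMap {X Y : ModuleCat.{u} R} (f : X ⟶ Y) :
    (ShortComplex.mk (syzygyMap f) f (syzygyMap_comp f)).Exact := by
  let α : ShortComplex.mk (syzygyMap f) f (by simp) ⟶ ShortComplex.mk (kernel.ι f) f (by simp) :=
    { τ₁ := (kernel f).coverπ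
      τ₂ := 𝟙 _
      τ₃ := 𝟙 _ }
  rw [ShortComplex.exact_iff_of_epi_of_isIso_of_mono α]
  apply ShortComplex.exact_of_f_is_kernel
  apply kernelIsKernel

variable (M : ModuleCat.{u} R)

/-- The complex of a projective resolution of `M` built from covers of iterated syzygies. -/
def coverComplex : ChainComplex (ModuleCat.{u} R) ℕ :=
  ChainComplex.mk' M.cover (kernel M.coverπ).cover (syzygyMap M.coverπ)
    (fun f => ⟨_, syzygyMap f, syzygyMap_comp f⟩)

/-- The augmentation of `M.coverComplex`. -/
def coverComplexπ : M.coverComplex.X 0 ⟶ M := M.coverπ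

instance : Epi M.coverComplexπ := inferInstanceAs (Epi M.coverπ)

theorem coverComplex_d_one_zero : M.coverComplex.d 1 0 = syzygyMap M.coverComplexπ :=
  ChainComplex.mk'_d_1_0 ..

theorem coverComplex_d_comp_π : M.coverComplex.d 1 0 ≫ M.coverComplexπ = 0 := by
  rw [coverComplex_d_one_zero]
  exact syzygyMap_comp M.coverComplexπ

theorem coverComplex_exact_zero :
    (ShortComplex.mk _ _ M.coverComplex_d_comp_π).Exact := by
  have h := exact_syzygyMap M.coverComplexπ
  simp only [← coverComplex_d_one_zero] at h
  exact h

/-- The terms of `M.coverComplex` above degree `1` are covers of kernels of differentials. -/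
def coverComplexXIso (n : ℕ) :
    M.coverComplex.X (n + 2) ≅ (kernel (M.coverComplex.d (n + 1) n)).cover :=
  ChainComplex.mk'XIso _ _ _ _ n

theorem coverComplex_d_succ (n : ℕ) : M.coverComplex.d (n + 2) (n + 1) =
    (M.coverComplexXIso n).hom ≫ syzygyMap (M.coverComplex.d (n + 1) n) :=
  ChainComplex.mk'_d _ _ _ _ n

theorem coverComplex_exactAt_succ (n : ℕ) : M.coverComplex.ExactAt (n + 1) := by
  rw [HomologicalComplex.exactAt_iff' _ (n + 2) (n + 1) n (by simp) (by simp)]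
  have h := exact_syzygyMap (M.coverComplex.d (n + 1) n)
  let e : ShortComplex.mk (syzygyMap (M.coverComplex.d (n + 1) n)) (M.coverComplex.d (n + 1) n)
      (syzygyMap_comp _) ≅ ShortComplex.mk (M.coverComplex.d (n + 2) (n + 1))
      (M.coverComplex.d (n + 1) n) (M.coverComplex.d_comp_d _ _ _) :=
    ShortComplex.isoMk (M.coverComplexXIso n).symm (Iso.refl _) (Iso.refl _)
      (by simp [coverComplex_d_succ]) (by simp)
  exact ShortComplex.exact_of_iso e h

instance (n : ℕ) : Projective (M.coverComplex.X n) := by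
  obtain _ | _ | n := n
  · exact inferInstanceAs (Projective M.cover)
  · exact inferInstanceAs (Projective (kernel M.coverπ).cover)
  · exact Projective.of_iso (M.coverComplexXIso n).symm inferInstance

theorem finite_kernel [IsNoetherianRing R] {X Y : ModuleCat.{u} R} (f : X ⟶ Y)
    [Module.Finite R X] : Module.Finite R (kernel f : ModuleCat.{u} R) :=
  Module.Finite.of_injective (kernel.ι f).hom ((ModuleCat.mono_iff_injective _).1 inferInstance)

theorem finite_coverComplex_X [IsNoetherianRing R] [Module.Finite R M] (n : ℕ) :
    Module.Finite R (M.coverComplex.X n) := by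
  induction n using Nat.strong_induction_on with
  | _ n ih =>
    obtain _ | _ | n := n
    · exact inferInstanceAs (Module.Finite R M.cover)
    · have := finite_kernel M.coverπ
      exact inferInstanceAs (Module.Finite R (kernel M.coverπ).cover)
    · have := ih (n + 1) (by omega)
      have := finite_kernel (M.coverComplex.d (n + 1) n)
      exact Module.Finite.equiv (M.coverComplexXIso n).symm.toLinearEquiv

/-- The projective resolution of `M` with complex `M.coverComplex`. -/
def coverResolution : ProjectiveResolution M where
  complex := M.coverComplex
  π := (ChainComplex.toSingle₀Equiv _ _).symm ⟨M.coverComplexπ, M.coverComplex_d_comp_π⟩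
  quasiIso := ChainComplex.quasiIso_toSingle₀Equiv_symm _ M.coverComplex_d_comp_π
    M.coverComplex_exact_zero M.coverComplex_exactAt_succ

end ModuleCat

theorem LinearMap.finite_int_of_finite {R M N : Type*} [CommRing R] [AddCommGroup M] [Module R M]
    [AddCommGroup N] [Module R N] [Module.Finite R M] [Module.Finite ℤ N] :
    Module.Finite ℤ (M →ₗ[R] N) := by
  obtain ⟨n, f, hf⟩ := Module.Finite.exists_fin' R M
  let g : (M →ₗ[R] N) →+ (Fin n → N) :=
    { toFun := fun φ k => φ (f (Pi.single k 1))
      map_zero' := rfl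
      map_add' := fun _ _ => rfl }
  refine Module.Finite.of_injective g.toIntLinearMap fun φ ψ h => ?_
  have : φ ∘ₗ f = ψ ∘ₗ f := by
    ext k
    exact congrFun h k
  exact (LinearMap.cancel_right hf).1 this

theorem AddCommGroup.finite_of_zsmul_eq_zero {M : Type*} [AddCommGroup M] [Module ℤ M]
    [Module.Finite ℤ M] (n : ℤ) (hn : n ≠ 0) (h : ∀ x : M, n • x = 0) : Finite M :=
  Module.finite_of_fg_torsion M fun x => ⟨⟨n, mem_nonZeroDivisors_of_ne_zero hn⟩,
    (int_smul_eq_zsmul _ n x).trans (h x)⟩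

namespace IsBRing

variable {I : Type} [Fintype I] {R : Subring (I → ℤ)}

theorem exists_single_mem (hR : IsBRing R) (i : I) :
    ∃ r ∈ R, r i ≠ 0 ∧ ∀ j, j ≠ i → r j = 0 := by
  classical
  have h : ∀ j : I, ∃ r ∈ R, r i ≠ 0 ∧ (j ≠ i → r j = 0) := fun j => by
    by_cases hj : j = i
    · exact ⟨1, R.one_mem, one_ne_zero, fun h => (h hj).elim⟩
    · obtain ⟨r, hr, h₁, h₂⟩ := hR i j (Ne.symm hj)
      exact ⟨r, hr, h₁, fun _ => h₂⟩
  choose r hr h₁ h₂ using h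
  refine ⟨∏ j, r j, R.prod_mem fun j _ => hr j, ?_, fun j hj => ?_⟩
  · rw [Finset.prod_apply]
    exact Finset.prod_ne_zero_iff.2 fun j _ => h₁ j
  · rw [Finset.prod_apply]
    exact Finset.prod_eq_zero (Finset.mem_univ j) (h₂ j hj)

theorem exists_factorization (hR : IsBRing R) (i : I) :
    ∃ (n : ℤ) (a : ZMod_ R i ⟶ ModuleCat.of R R) (b : ModuleCat.of R R ⟶ ZMod_ R i),
      n ≠ 0 ∧ a ≫ b = n • 𝟙 (ZMod_ R i) := by
  obtain ⟨r, hr, hri, hrj⟩ := hR.exists_single_mem i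
  let : Module R ℤ := Module.compHom ℤ ((Pi.evalRingHom (fun _ => ℤ) i).comp R.subtype)
  have smul_def : ∀ (s : R) (m : ℤ), s • m = s.1 i * m := fun _ _ => rfl
  let a : ℤ →ₗ[R] R :=
    { toFun := fun m => m • ⟨r, hr⟩
      map_add' := fun m m' => add_smul m m' _
      map_smul' := fun s m => by
        ext j
        by_cases hj : j = i
        · subst hj
          simp [smul_def, mul_assoc]
        · simp [hrj j hj] }
  let b : R →ₗ[R] ℤ :=
    { toFun := fun s => s.1 i
      map_add' := fun _ _ => rfl
      map_smul' := fun _ _ => rfl }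
  refine ⟨r i, ModuleCat.ofHom a, ModuleCat.ofHom b, hri, ?_⟩
  have h (m : ℤ) : b (a m) = r i * m := by
    change ((m • (⟨r, hr⟩ : R) : R) : I → ℤ) i = r i * m
    simp [mul_comm]
  ext m
  exact h m

end IsBRing

instance {I : Type} [Fintype I] (R : Subring (I → ℤ)) : Module.Finite ℤ R :=
  Module.Finite.of_injective R.subtype.toAddMonoidHom.toIntLinearMap Subtype.val_injective

instance {I : Type} (R : Subring (I → ℤ)) (i : I) : Module.Finite ℤ (ZMod_ R i) :=
  inferInstanceAs (Module.Finite ℤ ℤ)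

instance {I : Type} (R : Subring (I → ℤ)) (i : I) : Module.Finite R (ZMod_ R i) :=
  Module.Finite.of_restrictScalars_finite ℤ R (ZMod_ R i)

theorem ModuleCat.finite_Ext {R : Type u} [CommRing R] [IsNoetherianRing R] (M N : ModuleCat.{u} R)
    [Module.Finite R M] [Module.Finite ℤ N] (l : ℕ) :
    Module.Finite ℤ (((Ext ℤ (ModuleCat R) l).obj (Opposite.op M)).obj N) := by
  have (n : ℕ) : Module.Finite ℤ ((M.coverResolution.complex.linearYonedaObj ℤ N).X n) := by
    have := M.finite_coverComplex_X n
    have : Module.Finite ℤ (M.coverComplex.X n →ₗ[R] N) := LinearMap.finite_int_of_finite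
    let e : (M.coverComplex.X n →ₗ[R] N) ≃+ (M.coverComplex.X n ⟶ N) :=
      ModuleCat.homAddEquiv.symm
    exact Module.Finite.equiv e.toIntLinearEquiv
  have := (M.coverResolution.complex.linearYonedaObj ℤ N).finite_homology l
  exact Module.Finite.equiv (M.coverResolution.isoExt l N).symm.toLinearEquiv

theorem ModuleCat.finite_Tor {R : Type u} [CommRing R] [IsNoetherianRing R] (M N : ModuleCat.{u} R)
    [Module.Finite R M] [Module.Finite R N] (l : ℕ) :
    Module.Finite R (((Tor (ModuleCat R) l).obj M).obj N) := by
  let K := (((MonoidalCategory.tensoringLeft (ModuleCat R)).obj M).mapHomologicalComplex _).obj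
    N.coverResolution.complex
  have (n : ℕ) : Module.Finite R (K.X n) := by
    have := N.finite_coverComplex_X n
    exact inferInstanceAs (Module.Finite R (TensorProduct R M (N.coverComplex.X n)))
  have : Module.Finite R
      ((HomologicalComplex.homologyFunctor (ModuleCat R) _ l).obj K : ModuleCat R) :=
    K.finite_homology l
  exact Module.Finite.equiv (N.coverResolution.isoLeftDerivedObj _ l).symm.toLinearEquiv

/-- For a B-ring `R ⊆ Gh(I)`, every `Ext^l_R(ℤ_i, ℤ_j)` and `Tor^R_l(ℤ_i, ℤ_j)` with
`l ≥ 1` is finite. -/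
theorem stmt_1 (I : Type) [Fintype I] (R : Subring (I → ℤ)) (hR : IsBRing R)
    (i j : I) (l : ℕ) (hl : 1 ≤ l) :
    Finite (((Ext ℤ (ModuleCat R) l).obj (Opposite.op (ZMod_ R i))).obj (ZMod_ R j)) ∧
    Finite (((Tor (ModuleCat R) l).obj (ZMod_ R i)).obj (ZMod_ R j)) := by
  obtain ⟨l, rfl⟩ : ∃ k, l = k + 1 := ⟨l - 1, by omega⟩
  have : IsNoetherianRing R := IsNoetherianRing.of_finite ℤ R
  have : Projective (ModuleCat.of R R) := (IsProjective.iff_projective R).1 inferInstance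
  constructor
  · obtain ⟨n, a, b, hn, hab⟩ := hR.exists_factorization i
    have := ModuleCat.finite_Ext (ZMod_ R i) (ZMod_ R j) (l + 1)
    have h := congrArg Quiver.Hom.unop
      (((linearYoneda ℤ (ModuleCat R)).obj (ZMod_ R j)).rightOp.zsmul_id_leftDerived_succ_eq_zero
        a b n hab l)
    exact AddCommGroup.finite_of_zsmul_eq_zero n hn fun x => ConcreteCategory.congr_hom h x
  · obtain ⟨n, a, b, hn, hab⟩ := hR.exists_factorization j
    have := ModuleCat.finite_Tor (ZMod_ R i) (ZMod_ R j) (l + 1)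
    have : Module.Finite ℤ (((Tor (ModuleCat R) (l + 1)).obj (ZMod_ R i)).obj (ZMod_ R j)) :=
      Module.Finite.trans R _
    have h := ((MonoidalCategory.tensoringLeft (ModuleCat R)).obj
      (ZMod_ R i)).zsmul_id_leftDerived_succ_eq_zero a b n hab l
    exact AddCommGroup.finite_of_zsmul_eq_zero n hn fun x => ConcreteCategory.congr_hom h x
end
end

section
/- Let p be a prime, let S be a commutative ring which is free as a ℤ-module, let M be an S-module that is torsion-free as an abelian group, and let N be an S-module annihilated by p. Then for every l ≥ 0 there are isomorphisms Ext^l_S(M, N) ≅ Ext^l_{S/pS}(M/pM, N) and Tor^S_l(M, N) ≅ Tor^{S/pS}_l(M/pM, N), where N is regarded as an S/pS-module via the quotient map. -/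
open CategoryTheory

noncomputable section

/-- If an `S`-module `N` is annihilated by `p`, it becomes a module over `S/pS`. -/
def modOverQuotient (p : ℕ) (S : Type) [CommRing S] (N : Type) [AddCommGroup N] [Module S N]
    (hN : ∀ x : N, (p : ℕ) • x = 0) : Module (S ⧸ Ideal.span {(p : S)}) N :=
  (Module.IsTorsionBySet.module
    ((Module.isTorsionBySet_span_singleton_iff _).mpr
      (fun x => by rw [Nat.cast_smul_eq_nsmul]; exact hN x)))

section Auxiliary

open MonoidalCategory

universe u

section LeftDerived

variable {C D : Type*} [Category* C] [Category* D] [Abelian C] [Abelian D]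
  {F G H : C ⥤ D} [F.Additive] [G.Additive] [H.Additive]

/-- The short complex of chain complexes obtained by applying a complex of additive functors
`F ⟶ G ⟶ H` to a chain complex. -/
abbrev mapShortComplexOfFunctors (α : F ⟶ G) (β : G ⟶ H) (w : ∀ X, α.app X ≫ β.app X = 0)
    (K : ChainComplex C ℕ) : ShortComplex (ChainComplex D ℕ) :=
  ShortComplex.mk ((NatTrans.mapHomologicalComplex α _).app K)
    ((NatTrans.mapHomologicalComplex β _).app K) (by ext i : 1; exact w (K.X i))

variable {α : F ⟶ G} {β : G ⟶ H}

theorem mapShortComplexOfFunctors_shortExact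
    (w : ∀ X, α.app X ≫ β.app X = 0)
    (h : ∀ (P : C) [Projective P], (ShortComplex.mk _ _ (w P)).ShortExact)
    {X : C} (P : ProjectiveResolution X) :
    (mapShortComplexOfFunctors α β w P.complex).ShortExact :=
  HomologicalComplex.shortExact_of_degreewise_shortExact _ fun i => h (P.complex.X i)

/-- Dimension shifting along a sequence of functors which is short exact on projective objects and
whose middle term has vanishing higher left derived functors at `X`. -/
theorem CategoryTheory.Functor.nonempty_leftDerived_succ_succ_iso [HasProjectiveResolutions C]
    (w : ∀ X, α.app X ≫ β.app X = 0)
    (h : ∀ (P : C) [Projective P], (ShortComplex.mk _ _ (w P)).ShortExact) {X : C}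
    (hG : ∀ n, Limits.IsZero ((G.leftDerived (n + 1)).obj X)) (n : ℕ) :
    Nonempty ((H.leftDerived (n + 2)).obj X ≅ (F.leftDerived (n + 1)).obj X) := by
  let P := CategoryTheory.projectiveResolution X
  have hz (k : ℕ) := (hG k).of_iso (P.isoLeftDerivedObj G (k + 1)).symm
  exact ⟨P.isoLeftDerivedObj H (n + 2) ≪≫
    (mapShortComplexOfFunctors_shortExact w h P).δIso (n + 2) (n + 1) (by simp) (hz _) (hz _) ≪≫
    (P.isoLeftDerivedObj F (n + 1)).symm⟩

theorem CategoryTheory.ProjectiveResolution.opcyclesMap_fromLeftDerivedZero' (α : F ⟶ G) {X : C}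
    (P : ProjectiveResolution X) :
    HomologicalComplex.opcyclesMap ((NatTrans.mapHomologicalComplex α _).app P.complex) 0 ≫
      P.fromLeftDerivedZero' G = P.fromLeftDerivedZero' F ≫ α.app X := by
  rw [← cancel_epi (HomologicalComplex.pOpcycles _ _), HomologicalComplex.p_opcyclesMap_assoc,
    ProjectiveResolution.pOpcycles_comp_fromLeftDerivedZero',
    ← Category.assoc, ProjectiveResolution.pOpcycles_comp_fromLeftDerivedZero']
  exact (α.naturality (P.π.f 0)).symm

/-- The beginning of the long exact sequence of left derived functors for a sequence of right exact
functors which is short exact on projective objects. -/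
theorem CategoryTheory.Functor.exists_leftDerived_one_exact [HasProjectiveResolutions C]
    (w : ∀ X, α.app X ≫ β.app X = 0)
    [Limits.PreservesFiniteColimits F] [Limits.PreservesFiniteColimits G]
    (h : ∀ (P : C) [Projective P], (ShortComplex.mk _ _ (w P)).ShortExact) {X : C}
    (hG : Limits.IsZero ((G.leftDerived 1).obj X)) :
    ∃ (j : (H.leftDerived 1).obj X ⟶ F.obj X) (hj : j ≫ α.app X = 0),
      Mono j ∧ (ShortComplex.mk _ _ hj).Exact := by
  let P := CategoryTheory.projectiveResolution X
  have hS := mapShortComplexOfFunctors_shortExact w h P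
  let d : ((H.mapHomologicalComplex _).obj P.complex).homology 1 ⟶
    ((F.mapHomologicalComplex _).obj P.complex).homology 0 := hS.δ 1 0 (by simp)
  have hm : Mono d := hS.mono_δ 1 0 (by simp) (hG.of_iso (P.isoLeftDerivedObj G 1).symm)
  have hd : d ≫ HomologicalComplex.homologyMap
    ((NatTrans.mapHomologicalComplex α _).app P.complex) 0 = 0 := hS.δ_comp 1 0 (by simp)
  let eH : (H.leftDerived 1).obj X ≅ ((H.mapHomologicalComplex _).obj P.complex).homology 1 :=
    P.isoLeftDerivedObj H 1
  let eF : ((F.mapHomologicalComplex _).obj P.complex).homology 0 ≅ F.obj X :=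
    ChainComplex.isoHomologyι₀ _ ≪≫ asIso (P.fromLeftDerivedZero' F)
  let eG : ((G.mapHomologicalComplex _).obj P.complex).homology 0 ≅ G.obj X :=
    ChainComplex.isoHomologyι₀ _ ≪≫ asIso (P.fromLeftDerivedZero' G)
  have he : HomologicalComplex.homologyMap
      ((NatTrans.mapHomologicalComplex α _).app P.complex) 0 ≫ eG.hom = eF.hom ≫ α.app X := by
    simp [eF, eG, ← P.opcyclesMap_fromLeftDerivedZero' α]
  have hj : (eH.hom ≫ d ≫ eF.hom) ≫ α.app X = 0 := by
    rw [Category.assoc, Category.assoc, ← he, reassoc_of% hd, Limits.zero_comp, Limits.comp_zero]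
  refine ⟨_, hj, inferInstance, ?_⟩
  exact (ShortComplex.exact_iff_of_iso (ShortComplex.isoMk eH.symm eF eG
    (eH.inv_hom_id_assoc _) he.symm)).1 (hS.homology_exact₁ 1 0 (by simp))

end LeftDerived

theorem CategoryTheory.Functor.isZero_leftDerived_succ_of_preservesHomology
    {C D : Type*} [Category* C] [Category* D] [Abelian C] [Abelian D] [HasProjectiveResolutions C]
    {F : C ⥤ D} [F.Additive] [F.PreservesHomology] (X : C) (n : ℕ) : Limits.IsZero ((F.leftDerived (n + 1)).obj X) := by
  let P := CategoryTheory.projectiveResolution X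
  refine Limits.IsZero.of_iso ?_ (P.isoLeftDerivedObj F (n + 1))
  rw [HomologicalComplex.homologyFunctor_obj, ← HomologicalComplex.exactAt_iff_isZero_homology,
    HomologicalComplex.exactAt_iff' _ (n + 2) (n + 1) n (by simp) (by simp)]
  exact (P.exact_succ n).map F

section Tor

variable {R : Type u} [CommRing R]

theorem ModuleCat.isZero_tor_succ_of_flat (F N : ModuleCat.{u} R) [Module.Flat R F] (n : ℕ) :
    Limits.IsZero (((Tor (ModuleCat R) (n + 1)).obj F).obj N) := by
  have : Limits.PreservesFiniteLimits ((tensoringLeft _).obj F) :=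
    inferInstanceAs (Limits.PreservesFiniteLimits (tensorLeft F))
  have : Limits.PreservesFiniteColimits ((tensoringLeft _).obj F) :=
    inferInstanceAs (Limits.PreservesFiniteColimits (tensorLeft F))
  exact Functor.isZero_leftDerived_succ_of_preservesHomology N n

theorem ModuleCat.tensor_projective_shortExact {T : ShortComplex (ModuleCat.{u} R)}
    (hT : T.ShortExact) (w : ∀ X, ((tensoringLeft _).map T.f).app X ≫
      ((tensoringLeft _).map T.g).app X = 0)
    (P : ModuleCat.{u} R) [Projective P] :
    (ShortComplex.mk _ _ (w P)).ShortExact := by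
  have : Module.Projective R P := (IsProjective.iff_projective P).2 ‹_›
  exact hT.map_of_exact (tensorRight P)

theorem ModuleCat.tensoringLeft_map_comp_eq_zero (T : ShortComplex (ModuleCat.{u} R))
    (X : ModuleCat.{u} R) : ((tensoringLeft _).map T.f).app X ≫
      ((tensoringLeft _).map T.g).app X = 0 := by
  rw [← NatTrans.comp_app, ← Functor.map_comp, T.zero]
  exact MonoidalPreadditive.zero_whiskerRight

/-- Dimension shifting for `Tor` in the first variable. -/
theorem ModuleCat.nonempty_tor_succ_succ_iso {T : ShortComplex (ModuleCat.{u} R)}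
    (hT : T.ShortExact) [Module.Flat R T.X₂] (N : ModuleCat.{u} R) (n : ℕ) :
    Nonempty (((Tor (ModuleCat R) (n + 2)).obj T.X₃).obj N ≅
      ((Tor (ModuleCat R) (n + 1)).obj T.X₁).obj N) :=
  Functor.nonempty_leftDerived_succ_succ_iso (tensoringLeft_map_comp_eq_zero T)
    (tensor_projective_shortExact hT _) (isZero_tor_succ_of_flat T.X₂ N) n

theorem ModuleCat.exists_tor_one_exact {T : ShortComplex (ModuleCat.{u} R)}
    (hT : T.ShortExact) [Module.Flat R T.X₂] (N : ModuleCat.{u} R) :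
    ∃ j : ((Tor (ModuleCat R) 1).obj T.X₃).obj N →ₗ[R] TensorProduct R T.X₁ N,
      Function.Injective j ∧ Function.Exact j (T.f.hom.rTensor N) := by
  have (X : ModuleCat.{u} R) : Limits.PreservesFiniteColimits ((tensoringLeft _).obj X) :=
    inferInstanceAs (Limits.PreservesFiniteColimits (tensorLeft X))
  obtain ⟨j, hj, hm, he⟩ := Functor.exists_leftDerived_one_exact (tensoringLeft_map_comp_eq_zero T)
    (tensor_projective_shortExact hT _) (isZero_tor_succ_of_flat T.X₂ N 0)
  exact ⟨j.hom, (ModuleCat.mono_iff_injective j).1 hm,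
    (ShortComplex.ShortExact.moduleCat_exact_iff_function_exact _).1 he⟩

theorem ModuleCat.nonempty_tor_zero_iso (M N : ModuleCat.{u} R) :
    Nonempty (((Tor (ModuleCat R) 0).obj M).obj N ≃ₗ[R] TensorProduct R M N) := by
  have : Limits.PreservesFiniteColimits ((tensoringLeft _).obj M) :=
    inferInstanceAs (Limits.PreservesFiniteColimits (tensorLeft M))
  exact ⟨(((tensoringLeft _).obj M).leftDerivedZeroIsoSelf.app N).toLinearEquiv⟩

end Tor

section BaseChange

open TensorProduct

variable {S : Type u} [CommRing S] {a : S}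

theorem IsSMulRegular.of_flat_module (ha : IsSMulRegular S a) {M : Type*} [AddCommGroup M]
    [Module S M] [Module.Flat S M] : IsSMulRegular M a :=
  Module.Flat.isSMulRegular_of_isRegular
    ((Commute.isRegular_iff (Commute.all a)).2 ha.isLeftRegular)

theorem one_tmul_surjective_of_quotient (I : Ideal S) (M : Type*) [AddCommGroup M] [Module S M] :
    Function.Surjective (TensorProduct.mk S (S ⧸ I) M 1) :=
  TensorProduct.mk_surjective S M (S ⧸ I) Ideal.Quotient.mk_surjective

theorem one_tmul_eq_zero_iff_of_quotient_span {M : Type*} [AddCommGroup M] [Module S M] (x : M) :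
    (1 : S ⧸ Ideal.span {a}) ⊗ₜ[S] x = 0 ↔ ∃ y, a • y = x := by
  rw [← (TensorProduct.quotTensorEquivQuotSMul M (Ideal.span {a})).map_eq_zero_iff,
    ← map_one (Ideal.Quotient.mk _), TensorProduct.quotTensorEquivQuotSMul_mk_tmul, one_smul,
    Submodule.Quotient.mk_eq_zero, Submodule.ideal_span_singleton_smul,
    Submodule.mem_smul_pointwise_iff_exists]
  simp

theorem baseChange_injective_of_isSMulRegular {K F M : Type*} [AddCommGroup K] [AddCommGroup F]
    [AddCommGroup M] [Module S K] [Module S F] [Module S M] {f : K →ₗ[S] F} {g : F →ₗ[S] M}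
    (hf : Function.Injective f) (hfg : Function.Exact f g) (hM : IsSMulRegular M a) :
    Function.Injective (f.baseChange (S ⧸ Ideal.span {a})) := by
  rw [injective_iff_map_eq_zero]
  intro z hz
  obtain ⟨k, rfl⟩ := one_tmul_surjective_of_quotient _ _ z
  rw [TensorProduct.mk_apply, LinearMap.baseChange_tmul,
    one_tmul_eq_zero_iff_of_quotient_span] at hz
  obtain ⟨y, hy⟩ := hz
  have hgy : g y = 0 := hM <| by
    simp [← map_smul, hy, hfg.apply_apply_eq_zero]
  obtain ⟨k', rfl⟩ := (hfg y).1 hgy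
  rw [TensorProduct.mk_apply, one_tmul_eq_zero_iff_of_quotient_span]
  exact ⟨k', hf (by simp [hy])⟩

/-- Kernels of linear maps which are identified by compatible additive equivalences are
equivalent. -/
theorem nonempty_addEquiv_of_exact {R R' A B C A' B' C' : Type*} [Ring R] [Ring R']
    [AddCommGroup A] [AddCommGroup B] [AddCommGroup C] [Module R A] [Module R B] [Module R C]
    [AddCommGroup A'] [AddCommGroup B'] [AddCommGroup C'] [Module R' A'] [Module R' B']
    [Module R' C'] {j : A →ₗ[R] B} {f : B →ₗ[R] C} {j' : A' →ₗ[R'] B'} {f' : B' →ₗ[R'] C'}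
    (hj : Function.Injective j) (hjf : Function.Exact j f)
    (hj' : Function.Injective j') (hjf' : Function.Exact j' f')
    (e : B ≃+ B') (e' : C ≃+ C') (h : ∀ x, e' (f x) = f' (e x)) : Nonempty (A ≃+ A') := by
  refine ⟨(AddMonoidHom.ofInjective (f := j.toAddMonoidHom) hj).trans
    ((e.addSubgroupMap j.toAddMonoidHom.range).trans ((AddEquiv.addSubgroupCongr ?_).trans
      (AddMonoidHom.ofInjective (f := j'.toAddMonoidHom) hj').symm))⟩
  ext y
  obtain ⟨x, rfl⟩ := e.surjective y
  have h₁ : x ∈ j.toAddMonoidHom.range ↔ f x = 0 := (hjf x).symm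
  have h₂ : e x ∈ j'.toAddMonoidHom.range ↔ f' (e x) = 0 := (hjf' (e x)).symm
  rw [h₂, ← h, e'.map_eq_zero_iff, ← h₁]
  simp

variable {Q : Type u} [CommRing Q] [Algebra S Q] (N : Type u) [AddCommGroup N] [Module S N]
  [Module Q N] [IsScalarTower S Q N]

/-- Base change along `S → Q` does not affect the tensor product with a `Q`-module. -/
def tensorEquivBaseChangeTensor (M : Type u) [AddCommGroup M] [Module S M] :
    M ⊗[S] N ≃+ (Q ⊗[S] M) ⊗[Q] N :=
  (TensorProduct.comm S M N).toAddEquiv.trans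
    ((AlgebraTensorModule.cancelBaseChange S Q Q N M).symm.toAddEquiv.trans
      (TensorProduct.comm Q N (Q ⊗[S] M)).toAddEquiv)

theorem tensorEquivBaseChangeTensor_rTensor {M M' : Type u} [AddCommGroup M] [Module S M]
    [AddCommGroup M'] [Module S M'] (f : M →ₗ[S] M') (x : M ⊗[S] N) :
    tensorEquivBaseChangeTensor (Q := Q) N M' (f.rTensor N x) =
      (f.baseChange Q).rTensor N (tensorEquivBaseChangeTensor N M x) := by
  induction x with
  | zero => simp
  | tmul m n => simp [tensorEquivBaseChangeTensor]
  | add x y hx hy => simp only [map_add, hx, hy]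

theorem exists_free_presentation (S M : Type u) [CommRing S] [AddCommGroup M] [Module S M] :
    ∃ (F : Type u) (_ : AddCommGroup F) (_ : Module S F) (K : Type u) (_ : AddCommGroup K)
      (_ : Module S K) (f : K →ₗ[S] F) (g : F →ₗ[S] M), Module.Free S F ∧
      Function.Surjective g ∧ Function.Injective f ∧ Function.Exact f g :=
  ⟨M →₀ S, inferInstance, inferInstance,
    LinearMap.ker (Finsupp.linearCombination S (id : M → M)), inferInstance, inferInstance,
    Submodule.subtype _, Finsupp.linearCombination S id, inferInstance,
    Finsupp.linearCombination_id_surjective S M, Subtype.val_injective,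
    LinearMap.exact_subtype_ker_map _⟩

theorem nonempty_tor_addEquiv_baseChange (ha : IsSMulRegular S a)
    (N : Type u) [AddCommGroup N] [Module S N] [Module (S ⧸ Ideal.span {a}) N]
    [IsScalarTower S (S ⧸ Ideal.span {a}) N] (l : ℕ) (M : Type u) [AddCommGroup M] [Module S M]
    (hM : IsSMulRegular M a) :
    Nonempty (((Tor (ModuleCat S) l).obj (ModuleCat.of S M)).obj (ModuleCat.of S N) ≃+
      ((Tor (ModuleCat (S ⧸ Ideal.span {a})) l).obj
        (ModuleCat.of _ ((S ⧸ Ideal.span {a}) ⊗[S] M))).obj (ModuleCat.of _ N)) := by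
  induction l generalizing M with
  | zero =>
    obtain ⟨e⟩ := ModuleCat.nonempty_tor_zero_iso (ModuleCat.of S M) (ModuleCat.of S N)
    obtain ⟨e'⟩ := ModuleCat.nonempty_tor_zero_iso
      (ModuleCat.of (S ⧸ Ideal.span {a}) ((S ⧸ Ideal.span {a}) ⊗[S] M)) (ModuleCat.of _ N)
    exact ⟨e.toAddEquiv.trans ((tensorEquivBaseChangeTensor N M).trans e'.symm.toAddEquiv)⟩
  | succ l ih =>
    obtain ⟨F, _, _, K, _, _, f, g, _, hg, hf, hfg⟩ := exists_free_presentation S M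
    have hK : IsSMulRegular K a := (ha.of_flat_module (M := F)).of_injective f hf
    let T : ShortComplex (ModuleCat S) := ShortComplex.mk
      (ModuleCat.ofHom f) (ModuleCat.ofHom g) (ModuleCat.hom_ext hfg.linearMap_comp_eq_zero)
    have hT : T.ShortExact :=
      { exact := ModuleCat.shortComplex_exact _ hfg
        mono_f := (ModuleCat.mono_iff_injective _).2 hf
        epi_g := (ModuleCat.epi_iff_surjective _).2 hg }
    have hfg' : Function.Exact (f.baseChange (S ⧸ Ideal.span {a}))
      (g.baseChange (S ⧸ Ideal.span {a})) := lTensor_exact _ hfg hg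
    let T' : ShortComplex (ModuleCat (S ⧸ Ideal.span {a})) := ShortComplex.mk
      (ModuleCat.ofHom (f.baseChange (S ⧸ Ideal.span {a})))
      (ModuleCat.ofHom (g.baseChange (S ⧸ Ideal.span {a})))
      (ModuleCat.hom_ext hfg'.linearMap_comp_eq_zero)
    have hT' : T'.ShortExact :=
      { exact := ModuleCat.shortComplex_exact _ hfg'
        mono_f := (ModuleCat.mono_iff_injective _).2
          (baseChange_injective_of_isSMulRegular hf hfg hM)
        epi_g := (ModuleCat.epi_iff_surjective _).2 (LinearMap.lTensor_surjective _ hg) }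
    have : Module.Flat S T.X₂ := inferInstanceAs (Module.Flat S F)
    have : Module.Flat (S ⧸ Ideal.span {a}) T'.X₂ :=
      inferInstanceAs (Module.Flat _ ((S ⧸ Ideal.span {a}) ⊗[S] F))
    cases l with
    | zero =>
      obtain ⟨j, hj, hjf⟩ := ModuleCat.exists_tor_one_exact hT (ModuleCat.of S N)
      obtain ⟨j', hj', hjf'⟩ := ModuleCat.exists_tor_one_exact hT' (ModuleCat.of _ N)
      exact nonempty_addEquiv_of_exact hj hjf hj' hjf'
        (tensorEquivBaseChangeTensor N _) (tensorEquivBaseChangeTensor N _)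
        (tensorEquivBaseChangeTensor_rTensor N f)
    | succ l =>
      obtain ⟨e⟩ := ModuleCat.nonempty_tor_succ_succ_iso hT (ModuleCat.of S N) l
      obtain ⟨e'⟩ := ModuleCat.nonempty_tor_succ_succ_iso hT' (ModuleCat.of _ N) l
      obtain ⟨e''⟩ := ih K hK
      exact ⟨e.toLinearEquiv.toAddEquiv.trans (e''.trans e'.symm.toLinearEquiv.toAddEquiv)⟩

end BaseChange

section Ext

open TensorProduct

variable {S : Type u} [CommRing S] {a : S}

theorem ModuleCat.extendScalars_unit_shortExact {X : ModuleCat.{u} S} (hX : IsSMulRegular X a)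
    (w : (a • 𝟙 X) ≫ (ModuleCat.extendRestrictScalarsAdj
      (Ideal.Quotient.mk (Ideal.span {a}))).unit.app X = 0) :
    (ShortComplex.mk _ _ w).ShortExact where
  exact := by
    rw [ShortComplex.ShortExact.moduleCat_exact_iff_function_exact]
    exact fun x => one_tmul_eq_zero_iff_of_quotient_span x
  mono_f := (ModuleCat.mono_iff_injective _).2 hX
  epi_g := (ModuleCat.epi_iff_surjective _).2 (one_tmul_surjective_of_quotient _ X)

theorem ModuleCat.smul_comp_extendScalars_unit (X : ModuleCat.{u} S) :
    (a • 𝟙 X) ≫ (ModuleCat.extendRestrictScalarsAdj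
      (Ideal.Quotient.mk (Ideal.span {a}))).unit.app X = 0 := by
  ext x
  exact (one_tmul_eq_zero_iff_of_quotient_span (a • x)).2 ⟨x, rfl⟩

instance (I : Ideal S) : (ModuleCat.extendScalars.{u, u, u} (Ideal.Quotient.mk I)).Additive :=
  (ModuleCat.extendRestrictScalarsAdj.{u, u, u} (Ideal.Quotient.mk I)).left_adjoint_additive

/-- The sequence `0 ⟶ K ⟶ K ⟶ K / aK ⟶ 0` for a chain complex `K`. -/
abbrev smulShortComplexOfChainComplex (a : S) (K : ChainComplex (ModuleCat.{u} S) ℕ) :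
    ShortComplex (ChainComplex (ModuleCat.{u} S) ℕ) :=
  let r := Ideal.Quotient.mk (Ideal.span {a})
  let u := (ModuleCat.extendRestrictScalarsAdj r).unit
  ShortComplex.mk (X₁ := K) (X₂ := K)
    (X₃ := ((ModuleCat.extendScalars r ⋙ ModuleCat.restrictScalars r).mapHomologicalComplex _).obj K)
    (a • 𝟙 K)
    { f := fun i => u.app (K.X i)
      comm' := fun i j _ => (u.naturality (K.d i j)).symm }
    (by
      ext i : 1
      exact ModuleCat.smul_comp_extendScalars_unit (K.X i))

theorem smulShortComplexOfChainComplex_shortExact {K : ChainComplex (ModuleCat.{u} S) ℕ}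
    (hK : ∀ i, IsSMulRegular (K.X i) a) : (smulShortComplexOfChainComplex a K).ShortExact :=
  HomologicalComplex.shortExact_of_degreewise_shortExact _ fun i =>
    ModuleCat.extendScalars_unit_shortExact (hK i) (ModuleCat.smul_comp_extendScalars_unit _)

theorem quasiIso_extendScalars_map {K L : ChainComplex (ModuleCat.{u} S) ℕ} (φ : K ⟶ L)
    [QuasiIso φ] (hK : ∀ i, IsSMulRegular (K.X i) a) (hL : ∀ i, IsSMulRegular (L.X i) a) :
    QuasiIso (((ModuleCat.extendScalars
      (Ideal.Quotient.mk (Ideal.span {a}))).mapHomologicalComplex _).map φ) := by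
  let r := Ideal.Quotient.mk (Ideal.span {a})
  let ψ : smulShortComplexOfChainComplex a K ⟶ smulShortComplexOfChainComplex a L :=
    { τ₁ := φ
      τ₂ := φ
      τ₃ := ((ModuleCat.extendScalars r ⋙
        ModuleCat.restrictScalars r).mapHomologicalComplex _).map φ
      comm₁₂ := by simp
      comm₂₃ := by
        ext i : 1
        exact (ModuleCat.extendRestrictScalarsAdj r).unit.naturality (φ.f i) }
  have h : QuasiIso ψ.τ₃ := HomologicalComplex.HomologySequence.quasiIso_τ₃ ψ
    (smulShortComplexOfChainComplex_shortExact hK)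
    (smulShortComplexOfChainComplex_shortExact hL) ‹_› ‹_›
  have : QuasiIso (((ModuleCat.restrictScalars r).mapHomologicalComplex _).map
    (((ModuleCat.extendScalars r).mapHomologicalComplex _).map φ)) := h
  exact (HomologicalComplex.quasiIso_map_iff_of_preservesHomology _ _).1 this

/-- The base change to `S / aS` of a projective resolution of an `a`-torsion-free module. -/
def CategoryTheory.ProjectiveResolution.extendScalarsQuotient (ha : IsSMulRegular S a)
    {X : ModuleCat.{u} S} (hX : IsSMulRegular X a) (P : ProjectiveResolution X) :
    ProjectiveResolution ((ModuleCat.extendScalars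
      (Ideal.Quotient.mk (Ideal.span {a}))).obj X) where
  complex := ((ModuleCat.extendScalars
      (Ideal.Quotient.mk (Ideal.span {a}))).mapHomologicalComplex _).obj P.complex
  projective n := (ModuleCat.extendRestrictScalarsAdj _).map_projective _ (P.projective n)
  π := ((ModuleCat.extendScalars _).mapHomologicalComplex _).map P.π ≫
    (HomologicalComplex.singleMapHomologicalComplex _ _ _).hom.app _
  quasiIso := by
    have : QuasiIso (((ModuleCat.extendScalars
        (Ideal.Quotient.mk (Ideal.span {a}))).mapHomologicalComplex _).map P.π) := by
      refine quasiIso_extendScalars_map P.π (fun i => ?_) (fun i => ?_)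
      · have : Module.Projective S (P.complex.X i) :=
          (IsProjective.iff_projective _).2 (P.projective i)
        exact ha.of_flat_module
      · cases i with
        | zero => exact hX
        | succ i =>
          have := ModuleCat.subsingleton_of_isZero
            (HomologicalComplex.isZero_single_obj_X (ComplexShape.down ℕ) 0 X (i + 1) (by simp))
          exact fun x y _ => Subsingleton.elim _ _
    infer_instance

/-- The adjunction between extension and restriction of scalars on complexes of morphisms. -/
def linearYonedaObjExtendScalarsIso {Q : Type u} [CommRing Q] (f : S →+* Q)
    [(ModuleCat.extendScalars f).Additive]
    (K : ChainComplex (ModuleCat.{u} S) ℕ) (N : ModuleCat.{u} Q) :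
    ChainComplex.linearYonedaObj (((ModuleCat.extendScalars f).mapHomologicalComplex _).obj K) ℤ N ≅
      K.linearYonedaObj ℤ ((ModuleCat.restrictScalars f).obj N) :=
  HomologicalComplex.Hom.isoOfComponents (fun i => LinearEquiv.toModuleIso
    { (ModuleCat.extendRestrictScalarsAdj f).homAddEquiv (K.X i) N with
      map_smul' := fun n x =>
        map_zsmul ((ModuleCat.extendRestrictScalarsAdj f).homAddEquiv (K.X i) N) n x })
    (fun i j _ => by
      ext x
      exact ((ModuleCat.extendRestrictScalarsAdj f).homEquiv_naturality_left (K.d j i) x).symm)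

end Ext

section Main

open TensorProduct

variable {S : Type u} [CommRing S] {a : S}

/-- The isomorphism between the base change `Q ⊗[S] M` and `M ⧸ aM`, where `Q = S ⧸ aS`. -/
def extendScalarsQuotientIso (a : S) (M : Type u) [AddCommGroup M] [Module S M] :
    ModuleCat.of (S ⧸ Ideal.span {a}) ((S ⧸ Ideal.span {a}) ⊗[S] M) ≅
      ModuleCat.of (S ⧸ Ideal.span {a}) (M ⧸ (Ideal.span {a} • (⊤ : Submodule S M))) :=
  ((TensorProduct.quotTensorEquivQuotSMul M (Ideal.span {a})).extendScalarsOfSurjective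
    Ideal.Quotient.mk_surjective).toModuleIso

theorem nonempty_tor_addEquiv_quotient (ha : IsSMulRegular S a)
    (N : Type u) [AddCommGroup N] [Module S N] [Module (S ⧸ Ideal.span {a}) N]
    [IsScalarTower S (S ⧸ Ideal.span {a}) N] (l : ℕ) (M : Type u) [AddCommGroup M] [Module S M]
    (hM : IsSMulRegular M a) :
    Nonempty (((Tor (ModuleCat S) l).obj (ModuleCat.of S M)).obj (ModuleCat.of S N) ≃+
      ((Tor (ModuleCat (S ⧸ Ideal.span {a})) l).obj
        (ModuleCat.of _ (M ⧸ (Ideal.span {a} • (⊤ : Submodule S M))))).obj (ModuleCat.of _ N)) := by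
  obtain ⟨e⟩ := nonempty_tor_addEquiv_baseChange ha N l M hM
  exact ⟨e.trans (((Tor _ l).mapIso
    (extendScalarsQuotientIso a M)).app _).toLinearEquiv.toAddEquiv⟩

/-- Restricting the scalars of an `S ⧸ I`-module `N` along `S → S ⧸ I` gives back the `S`-module
`N`. -/
def restrictScalarsQuotientIso (I : Ideal S) (N : Type u) [AddCommGroup N] [Module S N]
    [Module (S ⧸ I) N] [IsScalarTower S (S ⧸ I) N] :
    (ModuleCat.restrictScalars (Ideal.Quotient.mk I)).obj (ModuleCat.of (S ⧸ I) N) ≅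
      ModuleCat.of S N :=
  let e : (ModuleCat.restrictScalars (Ideal.Quotient.mk I)).obj (ModuleCat.of (S ⧸ I) N) ≃ₗ[S]
      ModuleCat.of S N :=
    { AddEquiv.refl N with
      map_smul' := fun s n => algebraMap_smul (M := N) (S ⧸ I) s n }
  e.toModuleIso

theorem nonempty_ext_addEquiv_quotient (ha : IsSMulRegular S a)
    (N : Type u) [AddCommGroup N] [Module S N] [Module (S ⧸ Ideal.span {a}) N]
    [IsScalarTower S (S ⧸ Ideal.span {a}) N] (l : ℕ) (M : Type u) [AddCommGroup M] [Module S M]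
    (hM : IsSMulRegular M a) :
    Nonempty (((Ext ℤ (ModuleCat S) l).obj (.op (ModuleCat.of S M))).obj (ModuleCat.of S N) ≃+
      ((Ext ℤ (ModuleCat (S ⧸ Ideal.span {a})) l).obj
        (.op (ModuleCat.of _ (M ⧸ (Ideal.span {a} • (⊤ : Submodule S M)))))).obj
          (ModuleCat.of _ N)) := by
  let P := projectiveResolution (ModuleCat.of S M)
  let P' := P.extendScalarsQuotient ha hM
  let e₁ := ((Ext ℤ (ModuleCat S) l).obj (.op (ModuleCat.of S M))).mapIso
    (restrictScalarsQuotientIso (Ideal.span {a}) N).symm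
  let e₂ := P.isoExt (R := ℤ) l
    ((ModuleCat.restrictScalars (Ideal.Quotient.mk (Ideal.span {a}))).obj (ModuleCat.of _ N))
  let e₃ := (HomologicalComplex.homologyFunctor _ _ l).mapIso
    (linearYonedaObjExtendScalarsIso (Ideal.Quotient.mk (Ideal.span {a})) P.complex
      (ModuleCat.of _ N)).symm
  let e₄ := (P'.isoExt (R := ℤ) l (ModuleCat.of _ N)).symm
  let e₅ := ((Ext ℤ (ModuleCat (S ⧸ Ideal.span {a})) l).mapIso
    (extendScalarsQuotientIso a M).symm.op).app (ModuleCat.of _ N)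
  exact ⟨(e₁ ≪≫ e₂ ≪≫ e₃ ≪≫ e₄ ≪≫ e₅).toLinearEquiv.toAddEquiv⟩

theorem isSMulRegular_natCast_of_noZeroSMulDivisors {M : Type*} [AddCommGroup M] [Module S M]
    [NoZeroSMulDivisors ℤ M] {n : ℕ} (hn : n ≠ 0) : IsSMulRegular M (n : S) := by
  intro x y h
  have h' : (n : S) • x = (n : S) • y := h
  rw [Nat.cast_smul_eq_nsmul, Nat.cast_smul_eq_nsmul, ← natCast_zsmul, ← natCast_zsmul] at h'
  exact smul_right_injective M (Int.natCast_ne_zero.2 hn) h'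

end Main

end Auxiliary

/-- Let `p` be a prime, `S` a commutative ring free as a `ℤ`-module, `M` an `S`-module which is
torsion-free as an abelian group and `N` an `S`-module annihilated by `p`.  Then for every
`l ≥ 0`, `Ext^l_S(M, N) ≅ Ext^l_{S/pS}(M/pM, N)` and `Tor^S_l(M, N) ≅ Tor^{S/pS}_l(M/pM, N)`,
where `N` is regarded as an `S/pS`-module via the quotient map. -/
theorem stmt_3 (p : ℕ) (hp : p.Prime) (S : Type) [CommRing S] [Module.Free ℤ S]
    (M : Type) [AddCommGroup M] [Module S M] (hM : NoZeroSMulDivisors ℤ M)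
    (N : Type) [AddCommGroup N] [Module S N] (hN : ∀ x : N, (p : ℕ) • x = 0)
    (l : ℕ) :
    letI Q := S ⧸ Ideal.span {(p : S)}
    letI : Module Q N := modOverQuotient p S N hN
    Nonempty
      ((((Ext ℤ (ModuleCat S) l).obj (Opposite.op (ModuleCat.of S M))).obj (ModuleCat.of S N)) ≃+
       (((Ext ℤ (ModuleCat Q) l).obj
          (Opposite.op (ModuleCat.of Q (M ⧸ (Ideal.span {(p : S)} • (⊤ : Submodule S M)))))).obj
          (ModuleCat.of Q N))) ∧
    Nonempty
      ((((Tor (ModuleCat S) l).obj (ModuleCat.of S M)).obj (ModuleCat.of S N)) ≃+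
       (((Tor (ModuleCat Q) l).obj
          (ModuleCat.of Q (M ⧸ (Ideal.span {(p : S)} • (⊤ : Submodule S M))))).obj
          (ModuleCat.of Q N))) := by
  let : Module (S ⧸ Ideal.span {(p : S)}) N := modOverQuotient p S N hN
  have : IsScalarTower S (S ⧸ Ideal.span {(p : S)}) N :=
    Module.IsTorsionBySet.isScalarTower _
  have : NoZeroSMulDivisors ℤ S :=
    ⟨fun {n x} h => or_iff_not_imp_left.2 fun hn =>
      (IsRegular.of_ne_zero hn).left.isSMulRegular.of_flat_module (h.trans (smul_zero n).symm)⟩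
  have hpS : IsSMulRegular S (p : S) := isSMulRegular_natCast_of_noZeroSMulDivisors hp.ne_zero
  have hpM : IsSMulRegular M (p : S) := isSMulRegular_natCast_of_noZeroSMulDivisors hp.ne_zero
  exact ⟨nonempty_ext_addEquiv_quotient hpS N l M hpM, nonempty_tor_addEquiv_quotient hpS N l M hpM⟩
end
end

section
/- Let R ⊆ Gh(I) be a B-ring, p a prime, and i, j ∈ I. For l ≥ 1 let a_l be the p-rank of Ext^l_R(ℤ_i, ℤ_j) (the number of cyclic summands in its p-primary part, equal to dim_{𝔽_p}{x : px = 0}) and z_l the p-rank of Tor^R_l(ℤ_i, ℤ_j). Then z_l = a_{l+1} for all l ≥ 1. -/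
set_option synthInstance.maxHeartbeats 400000
set_option maxHeartbeats 1000000

noncomputable section

open CategoryTheory

/-- The `p`-rank of an abelian group `A`: the dimension over `𝔽_p` of `{x ∈ A | p • x = 0}`
(for a finite abelian group this is the number of cyclic summands of the `p`-primary part). -/
def pRank (p : ℕ) (A : Type*) [AddCommGroup A] : ℕ :=
  letI := AddSubgroup.torsionBy.zmodModule (A := A) (n := p)
  Module.finrank (ZMod p) (AddSubgroup.torsionBy A p)

/-- `ℤ_i`: the `R`-module `ℤ` where `r ∈ R ⊆ ∏_{i ∈ I} ℤ` acts by multiplication by `r i`. -/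
def ZInt {I : Type} (R : Subring (I → ℤ)) (i : I) : ModuleCat R :=
  letI : Module R ℤ := Module.compHom ℤ ((Pi.evalRingHom (fun _ => ℤ) i).comp R.subtype)
  ModuleCat.of R ℤ

section

open CategoryTheory Abelian

/-- Two groups that are quotients of isomorphic groups by corresponding subgroups are isomorphic. -/
lemma nonempty_addEquiv_of_surjective {Z A B : Type*} [AddCommGroup Z] [AddCommGroup A]
    [AddCommGroup B] (f : Z →+ A) (g : Z →+ B) (hf : Function.Surjective f)
    (hg : Function.Surjective g) (h : ∀ z, f z = 0 ↔ g z = 0) : Nonempty (A ≃+ B) := by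
  have hker : f.ker = g.ker := by
    ext z
    exact h z
  exact ⟨(QuotientAddGroup.quotientKerEquivOfSurjective f hf).symm.trans
    ((QuotientAddGroup.quotientAddEquivOfEq hker).trans
      (QuotientAddGroup.quotientKerEquivOfSurjective g hg))⟩

namespace CharacterModule

variable {R : Type*} [CommRing R] {A B C : Type*} [AddCommGroup A] [AddCommGroup B]
  [AddCommGroup C] [Module R A] [Module R B] [Module R C]

/-- A character of `B` that vanishes on the kernel of `g : B → C` extends along `g`. -/
lemma exists_dual_eq_of_ker (g : B →ₗ[R] C) (φ : CharacterModule B)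
    (h : ∀ b, g b = 0 → φ b = 0) : ∃ ψ, dual g ψ = φ := by
  obtain ⟨ψ, hψ⟩ := dual_surjective_of_injective ((LinearMap.ker g).liftQ g le_rfl)
    (LinearMap.ker_eq_bot.1 (Submodule.ker_liftQ_eq_bot' _ _ rfl))
    (QuotientAddGroup.lift (LinearMap.ker g).toAddSubgroup φ (fun b hb ↦ h b hb))
  exact ⟨ψ, DFunLike.ext _ _ fun b ↦ DFunLike.congr_fun hψ (Submodule.Quotient.mk b)⟩

/-- The homology of the dual of a short complex is the dual of its homology. -/
lemma exists_hom_homology (S : ShortComplex (ModuleCat R)) :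
    ∃ θ : LinearMap.ker (dual S.f.hom) →+ CharacterModule S.homology,
      Function.Surjective θ ∧ ∀ φ, θ φ = 0 ↔ ∃ ψ, dual S.g.hom ψ = φ.1 := by
  let H := LinearMap.ker S.g.hom ⧸ LinearMap.range S.moduleCatToCycles
  let e : S.homology ≃ₗ[R] H := S.moduleCatHomologyIso.toLinearEquiv
  let θ : LinearMap.ker (dual S.f.hom) →+ CharacterModule H :=
    { toFun φ := QuotientAddGroup.lift (LinearMap.range S.moduleCatToCycles).toAddSubgroup
        (φ.1.comp (LinearMap.ker S.g.hom).subtype.toAddMonoidHom) (by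
          rintro _ ⟨a, rfl⟩
          exact DFunLike.congr_fun (LinearMap.mem_ker.1 φ.2) a)
      map_zero' := by
        refine DFunLike.ext _ _ fun x ↦ ?_
        obtain ⟨x, rfl⟩ := Submodule.Quotient.mk_surjective _ x
        rfl
      map_add' _ _ := by
        refine DFunLike.ext _ _ fun x ↦ ?_
        obtain ⟨x, rfl⟩ := Submodule.Quotient.mk_surjective _ x
        rfl }
  refine ⟨(congr e.symm).toAddEquiv.toAddMonoidHom.comp θ,
    (congr e.symm).surjective.comp fun c ↦ ?_, fun φ ↦ ?_⟩
  · obtain ⟨φ, hφ⟩ := dual_surjective_of_injective (LinearMap.ker S.g.hom).subtype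
      (Submodule.injective_subtype _) (dual (Submodule.mkQ _) c)
    refine ⟨⟨φ, LinearMap.mem_ker.2 (DFunLike.ext _ _ fun a ↦ ?_)⟩, DFunLike.ext _ _ fun x ↦ ?_⟩
    · have h1 := DFunLike.congr_fun hφ (S.moduleCatToCycles a)
      have h2 : (Submodule.mkQ (LinearMap.range S.moduleCatToCycles)) (S.moduleCatToCycles a) = 0 :=
        (Submodule.Quotient.mk_eq_zero _).2 ⟨a, rfl⟩
      refine h1.trans ((congrArg c h2).trans (map_zero c))
    · obtain ⟨x, rfl⟩ := Submodule.Quotient.mk_surjective _ x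
      exact DFunLike.congr_fun hφ x
  · refine ((congr e.symm).map_eq_zero_iff (x := θ φ)).trans ⟨fun h ↦ ?_, ?_⟩
    · exact exists_dual_eq_of_ker _ _ fun b hb ↦
        (DFunLike.congr_fun h (Submodule.Quotient.mk (⟨b, hb⟩ : LinearMap.ker S.g.hom)) :)
    · rintro ⟨ψ, hψ⟩
      refine DFunLike.ext _ _ fun x ↦ ?_
      obtain ⟨x, rfl⟩ := Submodule.Quotient.mk_surjective _ x
      refine (DFunLike.congr_fun hψ.symm x.1).trans ?_
      change ψ (S.g.hom x.1) = 0
      rw [LinearMap.mem_ker.1 x.2, map_zero]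

/-- A bilinear pairing can be curried in either order. -/
noncomputable def flipEquiv : (A →ₗ[R] CharacterModule B) ≃+ (B →ₗ[R] CharacterModule A) :=
  ((homEquiv.trans (congr (TensorProduct.comm R A B))).trans homEquiv.symm).toAddEquiv

lemma flipEquiv_apply (f : A →ₗ[R] CharacterModule B) (a : A) (b : B) :
    flipEquiv f b a = f a b := rfl

end CharacterModule

namespace CharacterModule

variable {A : Type*} [AddCommGroup A]

lemma finite_addCircle_torsion {n : ℕ} (hn : 0 < n) :
    Finite {x : AddCircle (1 : ℚ) // n • x = 0} :=
  Set.Finite.subset (AddCircle.finite_torsion (1 : ℚ) hn) fun _ hx ↦ hx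

lemma finite_of_finite_dual [Finite (CharacterModule A)] : Finite A := by
  have := finite_addCircle_torsion (Nat.card_pos (α := CharacterModule A))
  refine Finite.of_injective
    (β := CharacterModule A → {x : AddCircle (1 : ℚ) // Nat.card (CharacterModule A) • x = 0})
    (fun a c ↦ ⟨c a, ?_⟩) fun a b hab ↦ ?_
  · exact DFunLike.congr_fun (card_nsmul_eq_zero' (x := c)) a
  · rw [← sub_eq_zero]
    refine eq_zero_of_character_apply fun c ↦ ?_
    rw [map_sub, sub_eq_zero]
    exact congrArg Subtype.val (congrFun hab c)

instance [Finite A] : Finite (CharacterModule A) := by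
  have := finite_addCircle_torsion (Nat.card_pos (α := A))
  refine Finite.of_injective (β := A → {x : AddCircle (1 : ℚ) // Nat.card A • x = 0})
    (fun c a ↦ ⟨c a, ?_⟩) fun c d h ↦ DFunLike.ext _ _ fun a ↦ congrArg Subtype.val (congrFun h a)
  rw [← map_nsmul, card_nsmul_eq_zero', map_zero]

/-- Evaluation `A → A⋆⋆`. -/
def eval : A →+ CharacterModule (CharacterModule A) where
  toFun a :=
    { toFun c := c a
      map_zero' := rfl
      map_add' _ _ := rfl }
  map_zero' := DFunLike.ext _ _ fun c ↦ map_zero c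
  map_add' _ _ := DFunLike.ext _ _ fun c ↦ map_add c _ _

lemma eval_injective : Function.Injective (eval (A := A)) :=
  (injective_iff_map_eq_zero _).2 fun _ ha ↦
    eq_zero_of_character_apply fun c ↦ DFunLike.congr_fun ha c

end CharacterModule

section pRank

variable {p : ℕ} {A B : Type*} [AddCommGroup A] [AddCommGroup B]

lemma card_torsionBy_eq_pow_pRank [Finite A] (hp : p.Prime) :
    Nat.card (AddSubgroup.torsionBy A p) = p ^ pRank p A := by
  let := AddSubgroup.torsionBy.zmodModule (A := A) (n := p)
  have := Fact.mk hp
  rw [pRank, Module.natCard_eq_pow_finrank (K := ZMod p), Nat.card_zmod]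

lemma pRank_le_of_injective [Finite B] (hp : p.Prime) (f : A →+ B) (hf : Function.Injective f) :
    pRank p A ≤ pRank p B := by
  have : Finite A := Finite.of_injective f hf
  rw [← Nat.pow_le_pow_iff_right hp.one_lt, ← card_torsionBy_eq_pow_pRank hp,
    ← card_torsionBy_eq_pow_pRank hp]
  refine Nat.card_le_card_of_injective (fun a ↦ ⟨f a.1, ?_⟩) fun a b h ↦
    Subtype.ext (hf (congrArg Subtype.val h))
  have ha : (p : ℤ) • a.1 = 0 := a.2
  change (p : ℤ) • f a.1 = 0
  rw [← map_zsmul, ha, map_zero]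

lemma pRank_congr [Finite B] (hp : p.Prime) (e : A ≃+ B) : pRank p A = pRank p B :=
  have : Finite A := Finite.of_equiv B e.symm
  (pRank_le_of_injective hp e.toAddMonoidHom e.injective).antisymm
    (pRank_le_of_injective hp e.symm.toAddMonoidHom e.symm.injective)

lemma card_quotient_range_nsmul [Finite A] (n : ℕ) :
    Nat.card (A ⧸ (nsmulAddMonoidHom (α := A) n).range) =
      Nat.card (AddSubgroup.torsionBy A n) := by
  have h1 := (nsmulAddMonoidHom (α := A) n).range.card_mul_index
  have h2 := (nsmulAddMonoidHom (α := A) n).ker.card_mul_index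
  rw [AddSubgroup.index_ker] at h2
  have h3 : (nsmulAddMonoidHom (α := A) n).ker = AddSubgroup.torsionBy A n := by
    ext a
    change n • a = 0 ↔ (n : ℤ) • a = 0
    rw [natCast_zsmul]
  rw [h3, ← h1, mul_comm] at h2
  exact (Nat.eq_of_mul_eq_mul_left Nat.card_pos h2).symm

lemma card_addCircle_torsion_le {n : ℕ} (hn : n ≠ 0) :
    Nat.card {x : AddCircle (1 : ℚ) // n • x = 0} ≤ n := by
  have h := AddCircle.card_torsion_le_of_isSMulRegular (1 : ℚ) n hn fun x y hxy ↦ by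
    simpa [hn] using hxy
  rw [← Set.Finite.cast_ncard_eq (AddCircle.finite_torsion (1 : ℚ) (Nat.pos_of_ne_zero hn))] at h
  rw [← Set.coe_ofPred, Nat.card_coe_set_eq]
  exact_mod_cast h

lemma card_characterModule_le [Fact p.Prime] [Finite A] [Module (ZMod p) A] :
    Nat.card (CharacterModule A) ≤ Nat.card A := by
  have hp : p.Prime := Fact.out
  let b := Module.finBasis (ZMod p) A
  have := CharacterModule.finite_addCircle_torsion hp.pos
  refine (Nat.card_le_card_of_injective (β := Fin (Module.finrank (ZMod p) A) →
    {x : AddCircle (1 : ℚ) // p • x = 0}) (fun c k ↦ ⟨c (b k), ?_⟩) fun c d hcd ↦ ?_).trans ?_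
  · rw [← map_nsmul, ← Nat.cast_smul_eq_nsmul (ZMod p), CharP.cast_eq_zero, zero_smul, map_zero]
  · have h : AddSubgroup.toZModSubmodule p (AddMonoidHom.eqLocus c d) = ⊤ := by
      rw [eq_top_iff, ← b.span_eq, Submodule.span_le]
      rintro _ ⟨k, rfl⟩
      exact congrArg Subtype.val (congrFun hcd k)
    refine DFunLike.ext _ _ fun x ↦ ?_
    have hx : x ∈ AddSubgroup.toZModSubmodule p (AddMonoidHom.eqLocus c d) :=
      h ▸ Submodule.mem_top
    exact hx
  · rw [Nat.card_fun, Nat.card_fin, Module.natCard_eq_pow_finrank (K := ZMod p) (V := A),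
      Nat.card_zmod]
    exact Nat.pow_le_pow_left (card_addCircle_torsion_le hp.ne_zero) _

lemma pRank_characterModule_le [Finite A] (hp : p.Prime) :
    pRank p (CharacterModule A) ≤ pRank p A := by
  have := Fact.mk hp
  rw [← Nat.pow_le_pow_iff_right hp.one_lt, ← card_torsionBy_eq_pow_pRank hp,
    ← card_torsionBy_eq_pow_pRank hp, ← card_quotient_range_nsmul (A := A)]
  let _ : Module (ZMod p) (A ⧸ (nsmulAddMonoidHom (α := A) p).range) :=
    AddCommGroup.zmodModule fun v ↦ by
      obtain ⟨a, rfl⟩ := QuotientAddGroup.mk_surjective v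
      exact (QuotientAddGroup.eq_zero_iff _).2 ⟨a, rfl⟩
  refine le_trans ?_ (card_characterModule_le (p := p)
    (A := A ⧸ (nsmulAddMonoidHom (α := A) p).range))
  refine Nat.card_le_card_of_injective
    (fun c : AddSubgroup.torsionBy (CharacterModule A) p ↦ QuotientAddGroup.lift _ c.1 ?_)
    fun c d hcd ↦ ?_
  · rintro _ ⟨x, rfl⟩
    have hc : (p : ℤ) • c.1 = 0 := c.2
    rw [natCast_zsmul] at hc
    exact (map_nsmul c.1 p x).trans (DFunLike.congr_fun hc x)
  · exact Subtype.ext (DFunLike.ext _ _ fun x ↦ DFunLike.congr_fun hcd (QuotientAddGroup.mk x))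

/-- A finite abelian group and its dual have the same `p`-rank. -/
lemma pRank_characterModule [Finite A] (hp : p.Prime) :
    pRank p (CharacterModule A) = pRank p A :=
  (pRank_characterModule_le hp).antisymm
    ((pRank_le_of_injective hp _ CharacterModule.eval_injective).trans
      (pRank_characterModule_le hp))

end pRank

/-- Homology of a short complex of modules as a quotient of the group of cycles. -/
lemma CategoryTheory.ShortComplex.exists_hom_homology {R : Type*} [Ring R]
    (S : ShortComplex (ModuleCat R)) :
    ∃ θ : LinearMap.ker S.g.hom →+ S.homology,
      Function.Surjective θ ∧ ∀ x, θ x = 0 ↔ ∃ y, S.f.hom y = x.1 := by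
  let e : S.homology ≃ₗ[R] (LinearMap.ker S.g.hom ⧸ LinearMap.range S.moduleCatToCycles) :=
    S.moduleCatHomologyIso.toLinearEquiv
  refine ⟨e.symm.toAddMonoidHom.comp
    (Submodule.mkQ (LinearMap.range S.moduleCatToCycles)).toAddMonoidHom,
    e.symm.surjective.comp (Submodule.mkQ_surjective _), fun x ↦ ?_⟩
  refine e.symm.map_eq_zero_iff.trans ((Submodule.Quotient.mk_eq_zero _).trans ?_)
  exact ⟨fun ⟨y, hy⟩ ↦ ⟨y, congrArg Subtype.val hy⟩, fun ⟨y, hy⟩ ↦ ⟨y, Subtype.ext hy⟩⟩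

section

universe v u

variable {C : Type u} [Category.{v} C] [Abelian C] [Linear ℤ C] [EnoughProjectives C]
  [HasExt.{v} C]

/-- `Ext` as a derived functor agrees with `Ext` defined through the derived category. -/
lemma CategoryTheory.nonempty_ext_addEquiv_ext (X Y : C) (n : ℕ) :
    Nonempty (((_root_.Ext ℤ C (n + 1)).obj (Opposite.op X)).obj Y ≃+ Ext X Y (n + 1)) := by
  let P := projectiveResolution X
  let K := P.complex.linearYonedaObj ℤ Y
  let S := K.sc' n (n + 1) (n + 2)
  let e : ((_root_.Ext ℤ C (n + 1)).obj (Opposite.op X)).obj Y ≃ₗ[ℤ] S.homology :=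
    (P.isoExt (n + 1) Y ≪≫
      K.homologyIsoSc' n (n + 1) (n + 2) (by simp) (by simp)).toLinearEquiv
  obtain ⟨θ, hθ, hθ'⟩ := S.exists_hom_homology
  let η : LinearMap.ker S.g.hom →+ Ext X Y (n + 1) :=
    AddMonoidHom.mk' (fun f ↦ P.extMk f.1 (n + 2) rfl f.2) fun f g ↦
      (P.add_extMk f.1 g.1 (n + 2) rfl f.2 g.2).symm
  obtain ⟨e'⟩ := nonempty_addEquiv_of_surjective θ η hθ (fun α ↦ by
    obtain ⟨f, hf, h⟩ := P.extMk_surjective α (n + 2) rfl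
    exact ⟨⟨f, hf⟩, h⟩) fun f ↦
    (hθ' f).trans (P.extMk_eq_zero_iff f.1 (n + 2) rfl f.2 n rfl).symm
  exact ⟨e.toAddEquiv.trans e'⟩

end

section

universe u

variable {R : Type u} [CommRing R] (M N : ModuleCat.{u} R)

/-- The dual of `Tor` is `Ext` into the dual. -/
lemma nonempty_characterModule_tor_addEquiv_ext (n : ℕ) :
    Nonempty (CharacterModule (((Tor (ModuleCat R) (n + 1)).obj M).obj N) ≃+
      Ext N (ModuleCat.of R (CharacterModule M)) (n + 1)) := by
  let Q := projectiveResolution N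
  let F := (MonoidalCategory.tensoringLeft (ModuleCat.{u} R)).obj M
  let K := (F.mapHomologicalComplex _).obj Q.complex
  let S := K.sc' (n + 2) (n + 1) n
  let e : ((Tor (ModuleCat R) (n + 1)).obj M).obj N ≃ₗ[R] S.homology :=
    (Q.isoLeftDerivedObj F (n + 1) ≪≫
      K.homologyIsoSc' (n + 2) (n + 1) n (by simp) (by simp)).toLinearEquiv
  obtain ⟨θ, hθ, hθ'⟩ := CharacterModule.exists_hom_homology S
  let c (k : ℕ) : (Q.complex.X k ⟶ ModuleCat.of R (CharacterModule M)) ≃+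
      CharacterModule (K.X k) :=
    (ModuleCat.homAddEquiv.trans CharacterModule.flipEquiv).trans
      (CharacterModule.homEquiv (R := R) (A := M) (B := Q.complex.X k)).toAddEquiv
  have hc (k m : ℕ) (f) : c k (Q.complex.d k m ≫ f) =
      CharacterModule.dual (K.d k m).hom (c m f) := by
    refine DFunLike.ext _ _ fun x ↦ ?_
    induction x using TensorProduct.induction_on with
    | zero => exact (map_zero _).trans (map_zero _).symm
    | add x y hx hy => exact (map_add _ _ _).trans ((congrArg₂ _ hx hy).trans (map_add _ _ _).symm)
    | tmul a b => rfl
  have hc' (k m : ℕ) (φ) : c k (Q.complex.d k m ≫ (c m).symm φ) =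
      CharacterModule.dual (K.d k m).hom φ :=
    (hc k m _).trans (congrArg _ ((c m).apply_symm_apply φ))
  have hker (φ : LinearMap.ker (CharacterModule.dual S.f.hom)) :
      Q.complex.d (n + 2) (n + 1) ≫ (c (n + 1)).symm φ.1 = 0 :=
    (c (n + 2)).injective ((hc' _ _ _).trans (φ.2.trans (map_zero (c (n + 2))).symm))
  have hext {f g : Q.complex.X (n + 1) ⟶ ModuleCat.of R (CharacterModule M)} (h : f = g) (hg) :
      Q.extMk f (n + 2) rfl (h ▸ hg) = Q.extMk g (n + 2) rfl hg := by
    subst h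
    rfl
  let η : LinearMap.ker (CharacterModule.dual S.f.hom) →+
      Ext N (ModuleCat.of R (CharacterModule M)) (n + 1) :=
    AddMonoidHom.mk' (fun φ ↦ Q.extMk ((c (n + 1)).symm φ.1) (n + 2) rfl (hker φ)) fun φ ψ ↦ by
      rw [Q.add_extMk]
      congr 1
  obtain ⟨e'⟩ := nonempty_addEquiv_of_surjective θ η hθ (fun α ↦ by
    obtain ⟨f, hf, rfl⟩ := Q.extMk_surjective α (n + 2) rfl
    refine ⟨⟨c (n + 1) f, (hc _ _ _).symm.trans
      ((congrArg (c (n + 2)) hf).trans (map_zero (c (n + 2))))⟩, ?_⟩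
    exact hext ((c (n + 1)).symm_apply_apply f) hf) fun φ ↦ by
    refine (hθ' φ).trans (Iff.trans ?_ (Q.extMk_eq_zero_iff _ (n + 2) rfl (hker φ) n rfl).symm)
    constructor
    · rintro ⟨ψ, hψ⟩
      exact ⟨(c n).symm ψ, (c (n + 1)).injective
        ((hc' _ _ _).trans (hψ.trans ((c (n + 1)).apply_symm_apply φ.1).symm))⟩
    · rintro ⟨g, hg⟩
      exact ⟨c n g, (hc _ _ _).symm.trans
        ((congrArg (c (n + 1)) hg).trans ((c (n + 1)).apply_symm_apply φ.1))⟩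
  exact ⟨(CharacterModule.congr e.symm).toAddEquiv.symm.trans e'⟩

end

section

universe u

variable {R : Type u} [CommRing R]

namespace CharacterModule

/-- The dual of a short complex of modules. -/
def dualShortComplex (S : ShortComplex (ModuleCat.{u} R)) : ShortComplex (ModuleCat.{u} R) where
  X₁ := ModuleCat.of R (CharacterModule S.X₃)
  X₂ := ModuleCat.of R (CharacterModule S.X₂)
  X₃ := ModuleCat.of R (CharacterModule S.X₁)
  f := ModuleCat.ofHom (dual S.g.hom)
  g := ModuleCat.ofHom (dual S.f.hom)
  zero := by
    refine ModuleCat.hom_ext (LinearMap.ext fun c ↦ DFunLike.ext _ _ fun x ↦ ?_)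
    exact (congrArg c (S.moduleCat_zero_apply x)).trans (map_zero c)

lemma shortExact_dualShortComplex {S : ShortComplex (ModuleCat.{u} R)} (hS : S.ShortExact) :
    (dualShortComplex S).ShortExact where
  exact := by
    rw [ShortComplex.moduleCat_exact_iff]
    intro (φ : CharacterModule S.X₂) hφ
    have hφ' : dual S.f.hom φ = 0 := hφ
    refine exists_dual_eq_of_ker S.g.hom φ fun b hb ↦ ?_
    obtain ⟨a, rfl⟩ := (ShortComplex.moduleCat_exact_iff S).1 hS.exact b hb
    exact DFunLike.congr_fun hφ' a
  mono_f := (ModuleCat.mono_iff_injective _).2 (dual_injective_of_surjective _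
    ((ModuleCat.epi_iff_surjective _).1 hS.epi_g))
  epi_g := (ModuleCat.epi_iff_surjective _).2 (dual_surjective_of_injective _
    ((ModuleCat.mono_iff_injective _).1 hS.mono_f))

lemma injective_of_flat (F : ModuleCat.{u} R) [Module.Flat R F] :
    Injective (ModuleCat.of R (CharacterModule F)) :=
  (Module.injective_iff_injective_object _ _).1 (Module.Flat.iff_characterModule_injective.1 ‹_›)

end CharacterModule

namespace CategoryTheory.Abelian.Ext

open CharacterModule

variable (M N : ModuleCat.{u} R)

lemma bijective_extClass_postcomp {C : Type*} [Category C] [Abelian C] [HasExt C]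
    {S : ShortComplex C} (hS : S.ShortExact) (X : C) (n m : ℕ) (h : n + 1 = m)
    (h₁ : ∀ x : Ext X S.X₂ n, x = 0) (h₂ : ∀ x : Ext X S.X₂ m, x = 0) :
    Function.Bijective (hS.extClass.postcomp X h) := by
  refine ⟨(injective_iff_map_eq_zero _).2 fun x hx ↦ ?_, fun x ↦
    covariant_sequence_exact₁ X hS x (h₂ _) h⟩
  obtain ⟨y, rfl⟩ := covariant_sequence_exact₃ X hS x h hx
  rw [h₁ y, zero_comp]

lemma bijective_extClass_precomp {C : Type*} [Category C] [Abelian C] [HasExt C]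
    {S : ShortComplex C} (hS : S.ShortExact) (Y : C) (n m : ℕ) (h : 1 + n = m)
    (h₁ : ∀ x : Ext S.X₂ Y n, x = 0) (h₂ : ∀ x : Ext S.X₂ Y m, x = 0) :
    Function.Bijective (hS.extClass.precomp Y h) := by
  refine ⟨(injective_iff_map_eq_zero _).2 fun x hx ↦ ?_, fun x ↦
    contravariant_sequence_exact₃ hS Y x (h₂ _) h⟩
  obtain ⟨y, rfl⟩ := contravariant_sequence_exact₁ hS Y x h hx
  rw [h₁ y, comp_zero]

lemma mk₀_comp_extClass_eq_zero_iff {C : Type*} [Category C] [Abelian C] [HasExt C]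
    {S : ShortComplex C} (hS : S.ShortExact) {X : C} (f : X ⟶ S.X₃) :
    (mk₀ f).comp hS.extClass (zero_add 1) = 0 ↔ ∃ g, g ≫ S.g = f := by
  refine ⟨fun hf ↦ ?_, ?_⟩
  · obtain ⟨y, hy⟩ := covariant_sequence_exact₃ X hS _ _ hf
    obtain ⟨g, rfl⟩ := addEquiv₀.symm.surjective y
    exact ⟨g, (mk₀_bijective _ _).1 ((mk₀_comp_mk₀ _ _).symm.trans hy)⟩
  · rintro ⟨g, rfl⟩
    rw [← mk₀_comp_mk₀, comp_assoc_of_second_deg_zero, hS.comp_extClass, comp_zero]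

lemma extClass_comp_mk₀_eq_zero_iff {C : Type*} [Category C] [Abelian C] [HasExt C]
    {S : ShortComplex C} (hS : S.ShortExact) {Y : C} (f : S.X₁ ⟶ Y) :
    hS.extClass.comp (mk₀ f) (add_zero 1) = 0 ↔ ∃ g, S.f ≫ g = f := by
  refine ⟨fun hf ↦ ?_, ?_⟩
  · obtain ⟨y, hy⟩ := contravariant_sequence_exact₁ hS _ _ _ hf
    obtain ⟨g, rfl⟩ := addEquiv₀.symm.surjective y
    exact ⟨g, (mk₀_bijective _ _).1 ((mk₀_comp_mk₀ _ _).symm.trans hy)⟩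
  · rintro ⟨g, rfl⟩
    rw [← mk₀_comp_mk₀, hS.extClass_comp_assoc]

/-- `Ext` into duals is symmetric. -/
lemma nonempty_characterModule_addEquiv_swap (n : ℕ) :
    Nonempty (Ext N (ModuleCat.of R (CharacterModule M)) (n + 1) ≃+
      Ext M (ModuleCat.of R (CharacterModule N)) (n + 1)) := by
  induction n generalizing M with
  | zero =>
    let S := M.projectiveShortComplex
    have hS : S.ShortExact := M.shortExact_projectiveShortComplex
    have hD := shortExact_dualShortComplex hS
    have : Projective S.X₂ := (IsProjective.iff_projective _).1 inferInstance
    have : Injective (dualShortComplex S).X₂ := injective_of_flat S.X₂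
    let c (X : ModuleCat.{u} R) : (N ⟶ ModuleCat.of R (CharacterModule X)) ≃+
        (X ⟶ ModuleCat.of R (CharacterModule N)) :=
      (ModuleCat.homAddEquiv.trans flipEquiv).trans ModuleCat.homAddEquiv.symm
    let α : (N ⟶ ModuleCat.of R (CharacterModule S.X₁)) →+
        Ext N (ModuleCat.of R (CharacterModule M)) 1 :=
      (hD.extClass.postcomp N (zero_add 1)).comp addEquiv₀.symm.toAddMonoidHom
    let β : (N ⟶ ModuleCat.of R (CharacterModule S.X₁)) →+
        Ext M (ModuleCat.of R (CharacterModule N)) 1 :=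
      (hS.extClass.precomp (ModuleCat.of R (CharacterModule N)) (add_zero 1)).comp
        (addEquiv₀.symm.toAddMonoidHom.comp (c S.X₁).toAddMonoidHom)
    refine nonempty_addEquiv_of_surjective α β ?_ ?_ fun f ↦
      (mk₀_comp_extClass_eq_zero_iff hD f).trans
        (Iff.trans ?_ (extClass_comp_mk₀_eq_zero_iff hS (c S.X₁ f)).symm)
    · exact (postcomp_extClass_surjective_of_projective_X₂ hD N 0).comp addEquiv₀.symm.surjective
    · exact (precomp_extClass_surjective_of_projective_X₂ _ hS 0).comp
        (addEquiv₀.symm.surjective.comp (c S.X₁).surjective)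
    · refine ⟨fun ⟨g, hg⟩ ↦ ⟨c S.X₂ g, congrArg (c S.X₁) hg⟩, fun ⟨g, hg⟩ ↦ ?_⟩
      obtain ⟨g, rfl⟩ := (c S.X₂).surjective g
      exact ⟨g, (c S.X₁).injective hg⟩
  | succ n ih =>
    let S := M.projectiveShortComplex
    have hS : S.ShortExact := M.shortExact_projectiveShortComplex
    have hD := shortExact_dualShortComplex hS
    have : Projective S.X₂ := (IsProjective.iff_projective _).1 inferInstance
    have : Injective (dualShortComplex S).X₂ := injective_of_flat S.X₂
    obtain ⟨e⟩ := ih S.X₁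
    exact ⟨(AddEquiv.ofBijective _ (bijective_extClass_postcomp hD N (n + 1) (n + 2) rfl
      eq_zero_of_injective eq_zero_of_injective)).symm.trans (e.trans
      (AddEquiv.ofBijective _ (bijective_extClass_precomp hS (ModuleCat.of R (CharacterModule N))
        (n + 1) (n + 2) (by lia) eq_zero_of_projective eq_zero_of_projective)))⟩

end CategoryTheory.Abelian.Ext

end

namespace IsBRing

variable {I : Type} [Fintype I] {R : Subring (I → ℤ)}

lemma exists_mem_forall_ne_eq_zero (hR : IsBRing R) (i : I) :
    ∃ e ∈ R, e i ≠ 0 ∧ ∀ k, k ≠ i → e k = 0 := by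
  classical
  choose! r hr h1 h2 using fun k (hk : i ≠ k) ↦ hR i k hk
  refine ⟨∏ k ∈ Finset.univ.erase i, r k,
    R.prod_mem fun k hk ↦ hr k (Finset.ne_of_mem_erase hk).symm,
    ?_, fun k hk ↦ ?_⟩
  · rw [Finset.prod_apply]
    exact Finset.prod_ne_zero_iff.2 fun k hk ↦ h1 k (Finset.ne_of_mem_erase hk).symm
  · rw [Finset.prod_apply]
    exact Finset.prod_eq_zero (Finset.mem_erase.2 ⟨hk, Finset.mem_univ k⟩) (h2 k hk.symm)

/-- Positive degree `Ext` groups out of `ℤ_i` are killed by a common nonzero integer. -/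
lemma exists_zsmul_ext_eq_zero (hR : IsBRing R) (i : I) :
    ∃ n : ℤ, n ≠ 0 ∧ ∀ (Y : ModuleCat.{0} R) (l : ℕ) (x : Ext (ZInt R i) Y (l + 1)), n • x = 0 := by
  obtain ⟨e, he, hei, hek⟩ := hR.exists_mem_forall_ne_eq_zero i
  refine ⟨e i, hei, fun Y l x ↦ ?_⟩
  let a : ZInt R i →ₗ[R] R :=
    { toFun (z : ℤ) := z • (⟨e, he⟩ : R)
      map_add' (z w : ℤ) := add_smul z w _
      map_smul' (r : R) (z : ℤ) := by
        refine Subtype.ext (funext fun k ↦ ?_)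
        change (r.1 i * z) * e k = r.1 k * (z * e k)
        by_cases hk : k = i
        · rw [hk, mul_assoc]
        · rw [hek k hk, mul_zero, mul_zero, mul_zero] }
  let b : R →ₗ[R] ZInt R i :=
    { toFun (r : R) := (r.1 i : ℤ)
      map_add' _ _ := rfl
      map_smul' _ _ := rfl }
  let a' : ZInt R i ⟶ ModuleCat.of R R := ModuleCat.homAddEquiv.symm a
  let b' : ModuleCat.of R R ⟶ ZInt R i := ModuleCat.homAddEquiv.symm b
  have hab : a' ≫ b' = e i • 𝟙 (ZInt R i) :=
    ModuleCat.hom_ext (LinearMap.ext fun (z : ℤ) ↦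
      (mul_comm z (e i) : b (a z) = e i * z))
  have : Projective (ModuleCat.of R R) := (IsProjective.iff_projective _).1 inferInstance
  calc e i • x = (Ext.mk₀ (e i • 𝟙 (ZInt R i))).comp x (zero_add (l + 1)) := by
        have h := map_zsmul ((x.postcomp (ZInt R i) (zero_add (l + 1))).comp
          Ext.addEquiv₀.symm.toAddMonoidHom) (e i) (𝟙 (ZInt R i))
        exact (congrArg (e i • ·) (Ext.mk₀_id_comp x)).symm.trans h.symm
    _ = 0 := by
        rw [← hab, ← Ext.mk₀_comp_mk₀_assoc,
          Ext.eq_zero_of_projective ((Ext.mk₀ b').comp x (zero_add (l + 1))), Ext.comp_zero]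

end IsBRing

section

variable {I : Type} (R : Subring (I → ℤ)) (i : I)

/-- `ℚ_i`: the rationals as an `R`-module through the `i`-th coordinate. -/
def QRat : ModuleCat R :=
  let _ : Module R ℚ := Module.compHom ℚ
    ((Int.castRingHom ℚ).comp ((Pi.evalRingHom (fun _ ↦ ℤ) i).comp R.subtype))
  ModuleCat.of R ℚ

/-- The inclusion `ℤ_i → ℚ_i`. -/
def ZInt.toQRat : ZInt R i →ₗ[R] QRat R i where
  toFun := (Int.cast : ℤ → ℚ)
  map_add' := (Int.cast_add : ∀ z w : ℤ, ((z + w : ℤ) : ℚ) = z + w)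
  map_smul' r := (Int.cast_mul (r.1 i) : ∀ z : ℤ, ((r.1 i * z : ℤ) : ℚ) = r.1 i * z)

/-- The map `ℚ_i → ℤ_i⋆` sending `q` to `z ↦ z q`. -/
def QRat.toDual : QRat R i →ₗ[R] CharacterModule (ZInt R i) where
  toFun (q : ℚ) := (zmultiplesHom (AddCircle (1 : ℚ)) (q : AddCircle (1 : ℚ)) : ℤ →+ _)
  map_add' (q q' : ℚ) := DFunLike.ext _ _ fun (z : ℤ) ↦ smul_add z (q : AddCircle (1 : ℚ)) q'
  map_smul' (r : R) (q : ℚ) := DFunLike.ext _ _ fun (z : ℤ) ↦ by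
    change z • (((r.1 i : ℚ) * q : ℚ) : AddCircle (1 : ℚ)) = (r.1 i * z) • (q : AddCircle (1 : ℚ))
    rw [← zsmul_eq_mul, AddCircle.coe_zsmul, smul_smul, mul_comm]

/-- The short complex `0 → ℤ_i → ℚ_i → ℤ_i⋆ → 0`. -/
def ZInt.shortComplex : ShortComplex (ModuleCat R) where
  X₁ := ZInt R i
  X₂ := QRat R i
  X₃ := ModuleCat.of R (CharacterModule (ZInt R i))
  f := ModuleCat.homAddEquiv.symm (ZInt.toQRat R i)
  g := ModuleCat.homAddEquiv.symm (QRat.toDual R i)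
  zero := ModuleCat.hom_ext (LinearMap.ext fun (n : ℤ) ↦ DFunLike.ext _ _ fun (z : ℤ) ↦ by
    change z • ((n : ℚ) : AddCircle (1 : ℚ)) = 0
    rw [(AddCircle.coe_eq_zero_iff (1 : ℚ)).2 ⟨n, by simp⟩, smul_zero])

lemma ZInt.shortExact_shortComplex : (ZInt.shortComplex R i).ShortExact where
  exact := by
    rw [ShortComplex.moduleCat_exact_iff]
    intro (q : ℚ) hq
    have h : (1 : ℤ) • (q : AddCircle (1 : ℚ)) = 0 :=
      DFunLike.congr_fun (show QRat.toDual R i q = 0 from hq) (1 : ℤ)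
    rw [one_smul, AddCircle.coe_eq_zero_iff] at h
    obtain ⟨n, hn⟩ := h
    exact ⟨n, (zsmul_one n).symm.trans hn⟩
  mono_f := (ModuleCat.mono_iff_injective _).2 (Int.cast_injective (α := ℚ))
  epi_g := (ModuleCat.epi_iff_surjective _).2 <| by
    intro (c : ℤ →+ AddCircle (1 : ℚ))
    obtain ⟨q, hq⟩ := QuotientAddGroup.mk_surjective (c 1)
    refine ⟨q, DFunLike.ext (F := ℤ →+ AddCircle (1 : ℚ)) _ _ fun z ↦ ?_⟩
    change z • (q : AddCircle (1 : ℚ)) = c z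
    refine (congrArg (z • ·) hq).trans ?_
    rw [← map_zsmul, zsmul_one, Int.cast_id]

variable {R}

lemma IsBRing.ext_qRat_eq_zero [Fintype I] (hR : IsBRing R) (j : I) (l : ℕ)
    (x : Ext (ZInt R i) (QRat R j) (l + 1)) : x = 0 := by
  obtain ⟨n, hn, h⟩ := hR.exists_zsmul_ext_eq_zero i
  let b : QRat R j →ₗ[R] QRat R j :=
    { toFun (q : ℚ) := (n : ℚ)⁻¹ * q
      map_add' (q q' : ℚ) := mul_add _ q q'
      map_smul' (r : R) (q : ℚ) := mul_left_comm _ (r.1 j : ℚ) q }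
  let b' : QRat R j ⟶ QRat R j := ModuleCat.homAddEquiv.symm b
  have hb : n • b' = 𝟙 _ := ModuleCat.hom_ext (LinearMap.ext fun (q : ℚ) ↦ by
    change n • ((n : ℚ)⁻¹ * q) = q
    rw [zsmul_eq_mul, mul_inv_cancel_left₀ (Int.cast_ne_zero.2 hn)])
  have h' := map_zsmul ((x.precomp (QRat R j) (add_zero (l + 1))).comp
    Ext.addEquiv₀.symm.toAddMonoidHom) n b'
  rw [hb] at h'
  exact (Ext.comp_mk₀_id x).symm.trans (h'.trans (h _ _ _))

lemma IsBRing.nonempty_ext_addEquiv [Fintype I] (hR : IsBRing R) (j : I) (l : ℕ) :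
    Nonempty (Ext (ZInt R i) (ModuleCat.of R (CharacterModule (ZInt R j))) (l + 1) ≃+
      Ext (ZInt R i) (ZInt R j) (l + 2)) :=
  ⟨AddEquiv.ofBijective _ (Ext.bijective_extClass_postcomp (ZInt.shortExact_shortComplex R j)
    (ZInt R i) (l + 1) (l + 2) rfl (hR.ext_qRat_eq_zero i j l) (hR.ext_qRat_eq_zero i j (l + 1)))⟩

lemma IsBRing.finite_ext [Fintype I] (hR : IsBRing R) (j : I) (l : ℕ) :
    Finite (Ext (ZInt R i) (ZInt R j) (l + 1)) := by
  have : Module.Finite ℤ R :=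
    Module.Finite.of_injective R.subtype.toAddMonoidHom.toIntLinearMap Subtype.val_injective
  have : IsNoetherianRing R := isNoetherian_of_tower ℤ inferInstance
  have (k : I) : Module.Finite ℤ (ZInt R k) := inferInstanceAs (Module.Finite ℤ ℤ)
  have (k : I) : Module.Finite R (ZInt R k) := Module.Finite.of_restrictScalars_finite ℤ R _
  have : Module.Finite ℤ (Ext (ZInt R i) (ZInt R j) (l + 1)) := Module.Finite.trans R _
  obtain ⟨n, hn, h⟩ := hR.exists_zsmul_ext_eq_zero i
  exact Module.finite_of_fg_torsion _ fun {x} ↦ ⟨⟨n, mem_nonZeroDivisors_of_ne_zero hn⟩, h _ _ x⟩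

end

end

/-- Let `R ⊆ Gh(I)` be a B-ring, `p` a prime and `i, j ∈ I`.  For `l ≥ 1` let `a_l` be the
`p`-rank of `Ext^l_R(ℤ_i, ℤ_j)` and `z_l` the `p`-rank of `Tor^R_l(ℤ_i, ℤ_j)`.  Then
`z_l = a_{l+1}` for all `l ≥ 1`. -/
theorem stmt_8 (I : Type) [Fintype I] (R : Subring (I → ℤ)) (hR : IsBRing R)
    (p : ℕ) (hp : p.Prime) (i j : I) (l : ℕ) (hl : 1 ≤ l) :
    pRank p (((Tor (ModuleCat R) l).obj (ZInt R i)).obj (ZInt R j)) =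
      pRank p (((Ext ℤ (ModuleCat R) (l + 1)).obj (Opposite.op (ZInt R i))).obj (ZInt R j)) := by
  obtain ⟨k, rfl⟩ := Nat.exists_eq_add_of_le' hl
  obtain ⟨e₁⟩ := nonempty_characterModule_tor_addEquiv_ext (ZInt R i) (ZInt R j) k
  obtain ⟨e₂⟩ := Abelian.Ext.nonempty_characterModule_addEquiv_swap (ZInt R i) (ZInt R j) k
  obtain ⟨e₃⟩ := hR.nonempty_ext_addEquiv i j k
  obtain ⟨e₄⟩ := nonempty_ext_addEquiv_ext (ZInt R i) (ZInt R j) (k + 1)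
  have := hR.finite_ext i j (k + 1)
  have : Finite (((Ext ℤ (ModuleCat R) (k + 1 + 1)).obj (Opposite.op (ZInt R i))).obj
    (ZInt R j)) := Finite.of_equiv _ e₄.symm.toEquiv
  let e := ((e₁.trans e₂).trans e₃).trans e₄.symm
  have := Finite.of_equiv _ e.symm.toEquiv
  have := CharacterModule.finite_of_finite_dual
    (A := ((Tor (ModuleCat R) (k + 1)).obj (ZInt R i)).obj (ZInt R j))
  rw [← pRank_characterModule hp]
  exact pRank_congr hp e
end
end

section
/- Let G be a finite group, H, J ≤ G subgroups such that for every rational prime p the subgroup O^p(H) is not conjugate in G to O^p(J). Then Ext^l_{A(G)}(ℤ_H, ℤ_J) = 0 for all l ≥ 0. -/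
set_option synthInstance.maxHeartbeats 400000
set_option maxHeartbeats 1000000

noncomputable section

open CategoryTheory

/-- Two subgroups of `G` are conjugate if one is `g H g⁻¹` for some `g ∈ G`. -/
def IsConjSubgroup {G : Type*} [Group G] (H J : Subgroup G) : Prop :=
  ∃ g : G, Subgroup.map (MulAut.conj g).toMonoidHom H = J

/-- The Burnside ring `A(G)` of a finite group `G`, realized via the mark homomorphisms as the
subring of the ghost ring `∏_{H ≤ G} ℤ` generated by the mark vectors `H ↦ |X^H|` of finite
`G`-sets `X`.  (Marks are constant on conjugacy classes of subgroups, so this is the image of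
the usual embedding `A(G) → ∏_{(H) ∈ ccs(G)} ℤ`, hence isomorphic to the Burnside ring.) -/
def burnsideRing (G : Type) [Group G] : Subring ((Subgroup G) → ℤ) :=
  Subring.closure { f | ∃ (X : Type) (_ : Fintype X) (_ : MulAction G X),
    f = fun H : Subgroup G => (Nat.card (MulAction.fixedPoints H X) : ℤ) }

/-- `ℤ_H`: the `A(G)`-module `ℤ` on which `a ∈ A(G)` acts by multiplication by `π_H(a)`,
the `H`-mark of `a`. -/
def ZB (G : Type) [Group G] (H : Subgroup G) : ModuleCat (burnsideRing G) :=
  letI : Module (burnsideRing G) ℤ :=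
    Module.compHom ℤ ((Pi.evalRingHom (fun _ => ℤ) H).comp (burnsideRing G).subtype)
  ModuleCat.of _ ℤ

/-- `O^p(H)`: the smallest normal subgroup `K ⊴ H` with `H/K` a `p`-group, regarded as a
subgroup of `G`. -/
def Op (p : ℕ) {G : Type*} [Group G] (H : Subgroup G) : Subgroup G :=
  (sInf {K : Subgroup H | ∃ _ : K.Normal, IsPGroup p (H ⧸ K)}).map H.subtype

/-- If some ring element acts as the identity on `M` and as zero on `N`, then all `Ext` modules
from `M` to `N` vanish. -/
theorem subsingleton_ext_of_smul {R : Type} [CommRing R] (M N : ModuleCat.{0} R) (a : R)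
    (hM : ∀ m : M, a • m = m) (hN : ∀ n : N, a • n = 0) (l : ℕ) :
    Subsingleton (((Ext R (ModuleCat.{0} R) l).obj (Opposite.op M)).obj N) := by
  let F := ((linearYoneda R (ModuleCat.{0} R)).obj N).rightOp
  let P := projectiveResolution M
  have hF : ∀ X : ModuleCat.{0} R, F.map (a • 𝟙 X) = 0 := by
    intro X
    refine Quiver.Hom.unop_inj ?_
    ext (f : X ⟶ N)
    change (a • 𝟙 X) ≫ f = 0
    ext x
    simp [hN]
  have key := F.leftDerived_map_eq l (𝟙 M) (P := P) (Q := P) (a • 𝟙 P.complex) (by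
    ext x
    simp only [CategoryTheory.Functor.map_id, Category.comp_id, Linear.smul_comp,
      Category.id_comp, HomologicalComplex.smul_f_apply]
    rw [ModuleCat.hom_smul, LinearMap.smul_apply]
    exact hM _)
  have hzero : (F.mapHomologicalComplex (ComplexShape.down ℕ)).map (a • 𝟙 P.complex) = 0 := by
    ext i : 1
    exact hF _
  rw [Functor.comp_map, hzero, Functor.map_zero, Limits.zero_comp, Limits.comp_zero,
    CategoryTheory.Functor.map_id] at key
  have hz : Limits.IsZero ((F.leftDerived l).obj M) :=
    (Limits.IsZero.iff_id_eq_zero _).2 key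
  exact ModuleCat.subsingleton_of_isZero hz.unop

/-- `K` is a normal subgroup of `L` all of whose quotient elements have `p`-power order. -/
structure IsPNormalIn (p : ℕ) {G : Type*} [Group G] (K L : Subgroup G) : Prop where
  le : K ≤ L
  conj_mem : ∀ x ∈ L, ∀ y ∈ K, x * y * x⁻¹ ∈ K
  exists_pow_mem : ∀ x ∈ L, ∃ k : ℕ, x ^ p ^ k ∈ K

section PNormal

variable {G : Type*} [Group G] {p : ℕ} {K L M : Subgroup G}

theorem pow_prime_pow_mem_of_le {x : G} {k m : ℕ} (hkm : k ≤ m) (hx : x ^ p ^ k ∈ K) :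
    x ^ p ^ m ∈ K := by
  obtain ⟨d, rfl⟩ := Nat.exists_eq_add_of_le hkm
  rw [pow_add, pow_mul]
  exact K.pow_mem hx _

namespace IsPNormalIn

theorem normal (h : IsPNormalIn p K L) : (K.subgroupOf L).Normal :=
  ⟨fun y hy x => h.conj_mem x x.2 y hy⟩

theorem isPGroup (h : IsPNormalIn p K L) :
    letI := h.normal
    IsPGroup p (L ⧸ K.subgroupOf L) := by
  let := h.normal
  intro g
  induction g using QuotientGroup.induction_on with
  | H x =>
    obtain ⟨k, hk⟩ := h.exists_pow_mem x x.2
    refine ⟨k, ?_⟩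
    rw [← QuotientGroup.mk_pow, QuotientGroup.eq_one_iff]
    exact hk

theorem inf_right (h : IsPNormalIn p K L) (hM : M ≤ L) : IsPNormalIn p (K ⊓ M) M where
  le := inf_le_right
  conj_mem x hx y hy := ⟨h.conj_mem x (hM hx) y hy.1,
    M.mul_mem (M.mul_mem hx hy.2) (M.inv_mem hx)⟩
  exists_pow_mem x hx := by
    obtain ⟨k, hk⟩ := h.exists_pow_mem x (hM hx)
    exact ⟨k, hk, M.pow_mem hx _⟩

theorem map {G' : Type*} [Group G'] (f : G →* G') (h : IsPNormalIn p K L) :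
    IsPNormalIn p (K.map f) (L.map f) where
  le := Subgroup.map_mono h.le
  conj_mem := by
    rintro _ ⟨x, hx, rfl⟩ _ ⟨y, hy, rfl⟩
    exact ⟨_, h.conj_mem x hx y hy, by simp⟩
  exists_pow_mem := by
    rintro _ ⟨x, hx, rfl⟩
    obtain ⟨k, hk⟩ := h.exists_pow_mem x hx
    exact ⟨k, _, hk, by simp⟩

theorem Op_le (h : IsPNormalIn p K L) : Op p L ≤ K := by
  rintro _ ⟨x, hx, rfl⟩
  exact Subgroup.mem_sInf.1 hx (K.subgroupOf L) ⟨h.normal, h.isPGroup⟩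

end IsPNormalIn

theorem isPNormalIn_Op [Finite G] (p : ℕ) (L : Subgroup G) : IsPNormalIn p (Op p L) L where
  le := Subgroup.map_subtype_le _
  conj_mem := by
    rintro x hx _ ⟨y, hy, rfl⟩
    refine ⟨⟨x, hx⟩ * y * ⟨x, hx⟩⁻¹, ?_, rfl⟩
    refine Subgroup.mem_sInf.2 fun K hK => ?_
    exact hK.1.conj_mem y (Subgroup.mem_sInf.1 hy K hK) _
  exists_pow_mem := by
    intro x hx
    have hpow : ∀ K : Subgroup L, (∃ _ : K.Normal, IsPGroup p (L ⧸ K)) →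
        ∃ k : ℕ, (⟨x, hx⟩ : L) ^ p ^ k ∈ K := by
      rintro K ⟨hK, hp⟩
      obtain ⟨k, hk⟩ := hp ((⟨x, hx⟩ : L) : L ⧸ K)
      refine ⟨k, ?_⟩
      rwa [← QuotientGroup.mk_pow, QuotientGroup.eq_one_iff] at hk
    choose! k hk using hpow
    obtain ⟨m, hm⟩ := (Set.finite_range k).bddAbove
    refine ⟨m, ⟨x, hx⟩ ^ p ^ m, ?_, rfl⟩
    exact Subgroup.mem_sInf.2 fun K hK =>
      pow_prime_pow_mem_of_le (hm ⟨K, rfl⟩) (hk K hK)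

theorem conj_mem_Op [Finite G] {g : G} (hg : ∀ y ∈ L, g * y * g⁻¹ ∈ L) :
    ∀ y ∈ Op p L, g * y * g⁻¹ ∈ Op p L := by
  have hmap : L.map (MulAut.conj g).toMonoidHom = L := by
    refine Subgroup.eq_of_le_of_card_ge ?_
      (Subgroup.card_map_of_injective (MulAut.conj g).injective).ge
    rintro _ ⟨y, hy, rfl⟩
    exact hg y hy
  have h := (isPNormalIn_Op p L).map (MulAut.conj g).toMonoidHom
  rw [hmap] at h
  have heq : Op p L = (Op p L).map (MulAut.conj g).toMonoidHom :=
    Subgroup.eq_of_le_of_card_ge h.Op_le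
      (Subgroup.card_map_of_injective (MulAut.conj g).injective).le
  intro y hy
  rw [heq]
  exact ⟨y, hy, rfl⟩

/-- The subgroup `O^p(L)` has no proper normal subgroup of `p`-power index. -/
theorem IsPNormalIn.Op_le_of_Op [Finite G] (h : IsPNormalIn p K (Op p L)) : Op p L ≤ K := by
  have hL := isPNormalIn_Op p L
  have hO := isPNormalIn_Op p (Op p L)
  refine (IsPNormalIn.Op_le ?_).trans h.Op_le
  refine ⟨hO.le.trans hL.le, fun x hx => conj_mem_Op (hL.conj_mem x hx), fun x hx => ?_⟩
  obtain ⟨k, hk⟩ := hL.exists_pow_mem x hx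
  obtain ⟨m, hm⟩ := hO.exists_pow_mem _ hk
  exact ⟨k + m, by rwa [pow_add, pow_mul]⟩

theorem IsPNormalIn.Op_le_of_le [Finite G] (h : IsPNormalIn p K M) (hM : Op p L ≤ M) :
    Op p L ≤ K :=
  (h.inf_right hM).Op_le_of_Op.trans inf_le_left

theorem IsPNormalIn.card_fixedPoints_modEq [Fact p.Prime] (h : IsPNormalIn p K L)
    (X : Type*) [MulAction G X] [Finite X] :
    Nat.card (MulAction.fixedPoints K X) ≡ Nat.card (MulAction.fixedPoints L X) [MOD p] := by
  let := h.normal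
  have key := h.isPGroup.card_modEq_card_fixedPoints
    (MulAction.fixedPoints (K.subgroupOf L) X)
  have e : ∀ x : X, x ∈ MulAction.fixedPoints (K.subgroupOf L) X ↔
      x ∈ MulAction.fixedPoints K X :=
    fun x => ⟨fun hx k => hx ⟨⟨k, h.le k.2⟩, k.2⟩, fun hx k => hx ⟨k, k.2⟩⟩
  rw [Nat.card_congr (Equiv.subtypeEquivRight e)] at key
  convert key using 1
  refine Nat.card_congr ⟨fun x => ⟨⟨x, fun k => x.2 k⟩, fun g => ?_⟩,
    fun x => ⟨x.1, fun g => ?_⟩, fun x => rfl, fun x => rfl⟩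
  · induction g using QuotientGroup.induction_on with
    | H g => exact Subtype.ext (x.2 g)
  · exact congrArg Subtype.val (x.2 (QuotientGroup.mk g))

theorem exists_isPNormalIn_not_dvd_relIndex_normalizer [Finite G] [Fact p.Prime]
    (Q : Subgroup G) :
    ∃ P : Subgroup G, IsPNormalIn p Q P ∧ P ≤ Subgroup.normalizer (Q : Set G) ∧
      ¬ p ∣ P.relIndex (Subgroup.normalizer (Q : Set G)) := by
  set N := Subgroup.normalizer (Q : Set G) with hN
  have hQN : Q ≤ N := Subgroup.le_normalizer
  have : (Q.subgroupOf N).Normal :=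
    ⟨fun y hy x => (Subgroup.mem_normalizer_iff.1 x.2 y).1 hy⟩
  let T : Sylow p (N ⧸ Q.subgroupOf N) := default
  let P' : Subgroup N := T.toSubgroup.comap (QuotientGroup.mk' (Q.subgroupOf N))
  have hle : P'.map N.subtype ≤ N := Subgroup.map_subtype_le _
  refine ⟨P'.map N.subtype, ⟨fun x hx => ?_, fun x hx y hy => ?_, ?_⟩, hle, ?_⟩
  · refine ⟨⟨x, hQN hx⟩, ?_, rfl⟩
    have hone : (QuotientGroup.mk' (Q.subgroupOf N)) ⟨x, hQN hx⟩ = 1 :=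
      (QuotientGroup.eq_one_iff _).2 hx
    change (QuotientGroup.mk' (Q.subgroupOf N)) ⟨x, hQN hx⟩ ∈ T
    rw [hone]
    exact one_mem _
  · exact (Subgroup.mem_normalizer_iff.1 (hle hx) y).1 hy
  · rintro _ ⟨x, hx, rfl⟩
    obtain ⟨k, hk⟩ := T.isPGroup' ⟨_, hx⟩
    refine ⟨k, ?_⟩
    have hk' : ((x ^ p ^ k : N) : N ⧸ Q.subgroupOf N) = 1 := congrArg Subtype.val hk
    have hmem := (QuotientGroup.eq_one_iff (x ^ p ^ k)).1 hk'
    exact hmem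
  · have hindex : (P'.map N.subtype).relIndex N = T.toSubgroup.index := by
      rw [Subgroup.relIndex, Subgroup.subgroupOf, Subgroup.comap_map_eq_self_of_injective
        N.subtype_injective, Subgroup.index_comap_of_surjective _
        (QuotientGroup.mk'_surjective _)]
    rw [hindex]
    exact T.not_dvd_index

theorem mk_mem_fixedPoints_iff (P Q : Subgroup G) (g : G) :
    (g : G ⧸ P) ∈ MulAction.fixedPoints Q (G ⧸ P) ↔ ∀ y ∈ Q, g⁻¹ * y * g ∈ P := by
  have hsmul : ∀ y ∈ Q, (y • (g : G ⧸ P) = g ↔ g⁻¹ * y * g ∈ P) := by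
    intro y _
    rw [eq_comm, MulAction.Quotient.smul_coe, QuotientGroup.eq, smul_eq_mul, mul_assoc]
  exact ⟨fun h y hy => (hsmul y hy).1 (h ⟨y, hy⟩), fun h y => (hsmul y y.2).2 (h y y.2)⟩

/-- If `gP` is fixed by `O^p(L)` and `K` is normal of `p`-power index in `P`, then
`O^p(L)` is conjugated into `K` by `g⁻¹`. -/
theorem IsPNormalIn.map_conj_Op_le [Finite G] {P : Subgroup G} (h : IsPNormalIn p K P) {g : G}
    (hg : (g : G ⧸ P) ∈ MulAction.fixedPoints (Op p L) (G ⧸ P)) :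
    (Op p L).map (MulAut.conj g⁻¹).toMonoidHom ≤ K := by
  have hle : Op p L ≤ P.map (MulAut.conj g).toMonoidHom := fun y hy =>
    ⟨g⁻¹ * y * g, (mk_mem_fixedPoints_iff P _ g).1 hg y hy, by simp [mul_assoc]⟩
  rintro _ ⟨y, hy, rfl⟩
  obtain ⟨z, hz, hzy⟩ := (h.map (MulAut.conj g).toMonoidHom).Op_le_of_le hle hy
  rw [← hzy]
  simpa [mul_assoc] using hz

theorem IsPNormalIn.card_fixedPoints_Op_quotient [Finite G] {P : Subgroup G}
    (h : IsPNormalIn p (Op p L) P) :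
    Nat.card (MulAction.fixedPoints (Op p L) (G ⧸ P)) =
      P.relIndex (Subgroup.normalizer (Op p L : Set G)) := by
  set Q := Op p L with hQ
  set N := Subgroup.normalizer (Q : Set G) with hN
  have horbit : MulAction.fixedPoints Q (G ⧸ P) = MulAction.orbit N ((1 : G) : G ⧸ P) := by
    ext x
    induction x using QuotientGroup.induction_on with
    | H g =>
      constructor
      · intro hg
        have hle := h.map_conj_Op_le hg
        have heq := Subgroup.eq_of_le_of_card_ge hle
          (Subgroup.card_map_of_injective (MulAut.conj g⁻¹).injective).ge
        have hmem : g⁻¹ ∈ N := Subgroup.mem_normalizer_iff_map_conj_eq.2 heq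
        refine ⟨⟨g, by simpa using N.inv_mem hmem⟩, ?_⟩
        change ((g * 1 : G) : G ⧸ P) = g
        rw [mul_one]
      · rintro ⟨n, hn⟩
        have hn' : ((n * 1 : G) : G ⧸ P) = g := hn
        rw [← hn', mul_one, mk_mem_fixedPoints_iff]
        exact fun y hy => h.le ((Subgroup.mem_normalizer_iff''.1 n.2 y).1 hy)
  have hstab : MulAction.stabilizer N ((1 : G) : G ⧸ P) = P.subgroupOf N := by
    ext n
    rw [MulAction.mem_stabilizer_iff, Subgroup.mem_subgroupOf]
    change ((n * 1 : G) : G ⧸ P) = (1 : G) ↔ _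
    rw [mul_one, eq_comm, QuotientGroup.eq, inv_one, one_mul]
  rw [Nat.card_coe_set_eq, horbit, ← MulAction.index_stabilizer, hstab, Subgroup.relIndex]

/-- If the `O^p(J)`-mark agrees modulo `p` with the `O^p(H)`-mark on all transitive `G`-sets,
then `O^p(J)` is conjugate to a subgroup of `O^p(H)`. -/
theorem exists_map_conj_Op_le [Finite G] [Fact p.Prime] {H J : Subgroup G}
    (h : ∀ P : Subgroup G, Nat.card (MulAction.fixedPoints H (G ⧸ P)) ≡
      Nat.card (MulAction.fixedPoints J (G ⧸ P)) [MOD p]) :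
    ∃ g : G, (Op p J).map (MulAut.conj g).toMonoidHom ≤ Op p H := by
  obtain ⟨P, hP, -, hdvd⟩ := exists_isPNormalIn_not_dvd_relIndex_normalizer (p := p) (Op p H)
  rw [← hP.card_fixedPoints_Op_quotient] at hdvd
  have hmod := (((isPNormalIn_Op p H).card_fixedPoints_modEq (G ⧸ P)).trans (h P)).trans
    ((isPNormalIn_Op p J).card_fixedPoints_modEq (G ⧸ P)).symm
  have hJ : ¬ p ∣ Nat.card (MulAction.fixedPoints (Op p J) (G ⧸ P)) := fun hp =>
    hdvd ((hmod.dvd_iff dvd_rfl).2 hp)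
  have hne : Nonempty (MulAction.fixedPoints (Op p J) (G ⧸ P)) := by
    by_contra hempty
    rw [not_nonempty_iff] at hempty
    exact hJ (by simp)
  obtain ⟨x, hx⟩ := hne
  induction x using QuotientGroup.induction_on with
  | H g => exact ⟨g⁻¹, hP.map_conj_Op_le hx⟩

theorem isConjSubgroup_Op_of_card_fixedPoints_modEq [Finite G] [Fact p.Prime]
    {H J : Subgroup G}
    (h : ∀ P : Subgroup G, Nat.card (MulAction.fixedPoints H (G ⧸ P)) ≡
      Nat.card (MulAction.fixedPoints J (G ⧸ P)) [MOD p]) :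
    IsConjSubgroup (Op p H) (Op p J) := by
  obtain ⟨g, hg⟩ := exists_map_conj_Op_le h
  obtain ⟨k, hk⟩ := exists_map_conj_Op_le fun P => (h P).symm
  refine ⟨k, Subgroup.eq_of_le_of_card_ge hk ?_⟩
  have hcard : ∀ (x : G) (K : Subgroup G),
      Nat.card (K.map (MulAut.conj x).toMonoidHom) = Nat.card K :=
    fun x K => Subgroup.card_map_of_injective (MulAut.conj x).injective
  rw [hcard, ← hcard g]
  exact Subgroup.card_le_of_le hg

end PNormal

/-- The class of a finite `G`-set in the Burnside ring. -/
def burnsideClass (G : Type) [Group G] (X : Type) [Finite X] [MulAction G X] : burnsideRing G :=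
  ⟨fun H => (Nat.card (MulAction.fixedPoints H X) : ℤ),
    Subring.subset_closure ⟨X, Fintype.ofFinite X, inferInstance, rfl⟩⟩

/-- If the marks `π_H` and `π_J` are distinct modulo every prime, they are comaximal. -/
theorem exists_mark_eq_one_and_eq_zero {G : Type} [Group G] (H J : Subgroup G)
    (h : ∀ p : ℕ, p.Prime → ∃ a : burnsideRing G, ¬ (p : ℤ) ∣ a.1 H - a.1 J) :
    ∃ a : burnsideRing G, a.1 H = 1 ∧ a.1 J = 0 := by
  let π (K : Subgroup G) : burnsideRing G →+* ℤ :=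
    (Pi.evalRingHom (fun _ => ℤ) K).comp (burnsideRing G).subtype
  have hsurj : Function.Surjective (π H) := fun n => ⟨n, by simp⟩
  let I : Ideal ℤ := (RingHom.ker (π J)).map (π H)
  have htop : I = ⊤ := by
    by_contra hI
    obtain ⟨m, hm, hle⟩ := Ideal.exists_le_maximal I hI
    have hmem : ∀ a : burnsideRing G, a.1 H - a.1 J ∈ m := by
      intro a
      have hker : a - ((a.1 J : ℤ) : burnsideRing G) ∈ RingHom.ker (π J) := by
        rw [RingHom.mem_ker, map_sub, map_intCast, sub_eq_zero]
        rfl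
      have := hle (Ideal.mem_map_of_mem (π H) hker)
      rwa [map_sub, map_intCast] at this
    obtain ⟨n, rfl⟩ : ∃ n : ℤ, m = Ideal.span {n} :=
      ⟨_, (Ideal.span_singleton_generator m).symm⟩
    have hn : n.natAbs ≠ 1 := fun hn => hm.ne_top
      (Ideal.span_singleton_eq_top.2 (Int.isUnit_iff_natAbs_eq.2 hn))
    obtain ⟨p, hp, hpn⟩ := Nat.exists_prime_and_dvd hn
    obtain ⟨a, ha⟩ := h p hp
    exact ha ((Int.natCast_dvd.2 hpn).trans (Ideal.mem_span_singleton.1 (hmem a)))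
  obtain ⟨a, ha, ha1⟩ := (Ideal.mem_map_iff_of_surjective (π H) hsurj).1
    ((Ideal.eq_top_iff_one I).1 htop)
  exact ⟨a, ha1, ha⟩

/-- Let `G` be a finite group and `H, J ≤ G` subgroups such that for every prime `p` the
subgroup `O^p(H)` is not conjugate in `G` to `O^p(J)`.  Then `Ext^l_{A(G)}(ℤ_H, ℤ_J) = 0`
for all `l ≥ 0`. -/
theorem stmt_15 (G : Type) [Group G] [Finite G] (H J : Subgroup G)
    (h : ∀ p : ℕ, p.Prime → ¬ IsConjSubgroup (Op p H) (Op p J)) (l : ℕ) :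
    Subsingleton
      (((Ext (burnsideRing G) (ModuleCat (burnsideRing G)) l).obj
        (Opposite.op (ZB G H))).obj (ZB G J)) := by
  obtain ⟨a, haH, haJ⟩ := exists_mark_eq_one_and_eq_zero H J fun p hp => by
    have : Fact p.Prime := ⟨hp⟩
    by_contra! hdvd
    refine h p hp (isConjSubgroup_Op_of_card_fixedPoints_modEq fun P => ?_)
    exact (Int.natCast_modEq_iff.1 (Int.modEq_iff_dvd.2 (hdvd (burnsideClass G (G ⧸ P))))).symm
  refine subsingleton_ext_of_smul _ _ a (fun (m : ℤ) => ?_) (fun (n : ℤ) => ?_) l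
  · change a.1 H * m = m
    rw [haH, one_mul]
  · change a.1 J * n = 0
    rw [haJ, zero_mul]
end
end
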